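/- Let A ⊆ ℂ̂ be any subset of the Riemann sphere. Then every holomorphic motion f : Δ × A → ℂ̂ extends to a holomorphic motion of the whole sphere: there exists a holomorphic motion F : Δ × ℂ̂ → ℂ̂ such that F(λ, a) = f(λ, a) for all λ ∈ Δ and a ∈ A. -/

import Mathlib

open Set Metric Complex

noncomputable section

/-- The antiholomorphic involution `z ↦ 1/z` on the Riemann sphere `ℂ̂ = OnePoint ℂ`. -/
def sphereInv (p : OnePoint ℂ) : OnePoint ℂ :=
  Option.elim p ((0 : ℂ) : OnePoint ℂ)
    (fun z => if z = 0 then OnePoint.infty else ((z⁻¹ : ℂ) : OnePoint ℂ))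

/-- A sphere-valued function is holomorphic on `s` if near every point it is, in one of the two
standard charts on `ℂ̂`, given by an analytic ℂ-valued function. -/
def HolomorphicOnSphere (u : ℂ → OnePoint ℂ) (s : Set ℂ) : Prop :=
  ∀ z ∈ s, ∃ v : ℂ → ℂ, AnalyticAt ℂ v z ∧
    ((∀ᶠ w in nhds z, u w = ((v w : ℂ) : OnePoint ℂ)) ∨
     (∀ᶠ w in nhds z, sphereInv (u w) = ((v w : ℂ) : OnePoint ℂ)))

/-- A holomorphic motion of `A ⊆ ℂ̂` over the unit disk `Δ`: holomorphic in `λ`,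
injective in `a` for each fixed `λ`, and the identity at `λ = 0`. -/
def IsHolomorphicMotion (A : Set (OnePoint ℂ)) (f : ℂ → OnePoint ℂ → OnePoint ℂ) : Prop :=
  (∀ a ∈ A, HolomorphicOnSphere (fun l => f l a) (ball (0 : ℂ) 1)) ∧
  (∀ l ∈ ball (0 : ℂ) 1, Set.InjOn (f l) A) ∧
  (∀ a ∈ A, f 0 a = a)

namespace Slodkowski

section CauchyTransform

open MeasureTheory

theorem integrableOn_inv_norm : IntegrableOn (fun x : ℂ => ‖x‖⁻¹) (closedBall 0 1) := by
  rw [← integrable_indicator_iff measurableSet_closedBall]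
  have h : (closedBall (0 : ℂ) 1).indicator (fun x : ℂ => ‖x‖⁻¹)
      = fun x : ℂ => (Iic (1 : ℝ)).indicator (fun y => y⁻¹) ‖x‖ := by
    ext x
    by_cases hx : ‖x‖ ≤ 1 <;> simp [hx]
  rw [h, integrable_fun_norm_addHaar volume (f := (Iic (1 : ℝ)).indicator (fun y => y⁻¹))]
  have h2 : IntegrableOn ((Iic (1 : ℝ)).indicator (fun _ => (1 : ℝ))) (Ioi 0) := by
    rw [integrableOn_indicator_iff measurableSet_Iic]
    simp [integrableOn_const_iff, Set.Iic_inter_Ioi]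
  refine h2.congr_fun ?_ measurableSet_Ioi
  intro y hy
  have : y ≠ 0 := (mem_Ioi.1 hy).ne'
  by_cases hy1 : y ≤ 1 <;> simp [hy1, this]

/-- The mass of the singular kernel over the unit disk, up to a bounded contribution. -/
def kernelConst : ℝ := (∫ x in closedBall (0 : ℂ) 1, ‖x‖⁻¹) + volume.real (closedBall (0 : ℂ) 1)

theorem kernelConst_nonneg : 0 ≤ kernelConst :=
  add_nonneg (setIntegral_nonneg measurableSet_closedBall fun _ _ => by positivity)
    measureReal_nonneg

theorem kernel_bound (z : ℂ) :
    IntegrableOn (fun x : ℂ => ‖z - x‖⁻¹) (closedBall 0 1) ∧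
      ∫ x in closedBall (0 : ℂ) 1, ‖z - x‖⁻¹ ≤ kernelConst := by
  set k : ℂ → ℝ := (closedBall (0 : ℂ) 1).indicator (fun x : ℂ => ‖x‖⁻¹) with hk
  set o : ℂ → ℝ := (closedBall (0 : ℂ) 1).indicator (fun _ : ℂ => (1 : ℝ)) with ho
  have hki : Integrable k := (integrable_indicator_iff measurableSet_closedBall).2 integrableOn_inv_norm
  have hkz : Integrable (fun x => k (z - x)) := hki.comp_sub_left z
  have hoi : Integrable o := by
    rw [ho, integrable_indicator_iff measurableSet_closedBall]
    exact integrableOn_const measure_closedBall_lt_top.ne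
  set u : ℂ → ℝ := (closedBall (0 : ℂ) 1).indicator (fun x : ℂ => ‖z - x‖⁻¹) with hu
  have hle : ∀ x, ‖u x‖ ≤ k (z - x) + o x := by
    intro x
    by_cases hx : x ∈ closedBall (0 : ℂ) 1
    · simp only [hu, ho, hk, indicator_of_mem hx, norm_inv, norm_norm]
      by_cases hzx : z - x ∈ closedBall (0 : ℂ) 1
      · simp [indicator_of_mem hzx]
      · rw [indicator_of_notMem hzx, zero_add]
        rw [mem_closedBall_zero_iff, not_le] at hzx
        exact inv_le_one_of_one_le₀ hzx.le
    · rw [hu, indicator_of_notMem hx, norm_zero]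
      exact add_nonneg (indicator_nonneg (fun _ _ => by positivity) _)
        (indicator_nonneg (fun _ _ => by positivity) _)
  have hum : AEStronglyMeasurable u volume := by
    refine (Measurable.indicator ?_ measurableSet_closedBall).aestronglyMeasurable
    fun_prop
  have hui : Integrable u := (hkz.add hoi).mono' hum (Filter.Eventually.of_forall hle)
  refine ⟨(integrable_indicator_iff measurableSet_closedBall).1 hui, ?_⟩
  rw [← integral_indicator measurableSet_closedBall]
  calc ∫ x, u x ≤ ∫ x, (k (z - x) + o x) :=
        integral_mono hui (hkz.add hoi) fun x => (le_abs_self _).trans (hle x)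
    _ = (∫ x, k (z - x)) + ∫ x, o x := integral_add hkz hoi
    _ = kernelConst := by
      rw [integral_sub_left_eq_self k volume z, hk, ho, integral_indicator measurableSet_closedBall,
        integral_indicator measurableSet_closedBall, kernelConst]
      simp

/-- Measurable functions bounded by `m` and vanishing off the closed unit disk. -/
structure DiskBounded (m : ℝ) (g : ℂ → ℂ) : Prop where
  meas : Measurable g
  bound : ∀ z, ‖g z‖ ≤ m
  supp : ∀ z, z ∉ closedBall (0 : ℂ) 1 → g z = 0

/-- The Cauchy transform `z ↦ ∫ g ζ / (z - ζ)`. -/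
def cauchyT (g : ℂ → ℂ) (z : ℂ) : ℂ := ∫ ζ, g ζ / (z - ζ)

variable {m m' : ℝ} {g a b A : ℂ → ℂ}

theorem DiskBounded.norm_div_le (hg : DiskBounded m g) (z ζ : ℂ) :
    ‖g ζ / (z - ζ)‖ ≤ m * (closedBall (0 : ℂ) 1).indicator (fun x : ℂ => ‖z - x‖⁻¹) ζ := by
  by_cases hx : ζ ∈ closedBall (0 : ℂ) 1
  · rw [indicator_of_mem hx, norm_div, div_eq_mul_inv]
    gcongr
    exact hg.bound ζ
  · simp [hg.supp ζ hx, indicator_of_notMem hx]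

theorem integrable_kernel (m : ℝ) (z : ℂ) :
    Integrable fun ζ => m * (closedBall (0 : ℂ) 1).indicator (fun x : ℂ => ‖z - x‖⁻¹) ζ :=
  ((integrable_indicator_iff measurableSet_closedBall).2 (kernel_bound z).1).const_mul m

theorem DiskBounded.integrable (hg : DiskBounded m g) (z : ℂ) :
    Integrable fun ζ => g ζ / (z - ζ) := by
  refine (integrable_kernel m z).mono' ?_ (Filter.Eventually.of_forall (hg.norm_div_le z))
  have := hg.meas
  exact Measurable.aestronglyMeasurable (by fun_prop)

theorem DiskBounded.nonneg (hg : DiskBounded m g) : 0 ≤ m := (norm_nonneg _).trans (hg.bound 0)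

theorem DiskBounded.integral_norm_le (hg : DiskBounded m g) (z : ℂ) :
    ∫ ζ, ‖g ζ / (z - ζ)‖ ≤ m * kernelConst := by
  calc ∫ ζ, ‖g ζ / (z - ζ)‖
      ≤ ∫ ζ, m * (closedBall (0 : ℂ) 1).indicator (fun x : ℂ => ‖z - x‖⁻¹) ζ :=
        integral_mono (hg.integrable z).norm (integrable_kernel m z) (hg.norm_div_le z)
    _ = m * ∫ x in closedBall (0 : ℂ) 1, ‖z - x‖⁻¹ := by
        rw [integral_const_mul, integral_indicator measurableSet_closedBall]
    _ ≤ m * kernelConst := mul_le_mul_of_nonneg_left (kernel_bound z).2 hg.nonneg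

theorem DiskBounded.norm_cauchyT_le (hg : DiskBounded m g) (z : ℂ) :
    ‖cauchyT g z‖ ≤ m * kernelConst :=
  (norm_integral_le_integral_norm _).trans (hg.integral_norm_le z)

theorem measurable_cauchyT (hg : Measurable g) : Measurable (cauchyT g) := by
  have : StronglyMeasurable (Function.uncurry fun z ζ : ℂ => g ζ / (z - ζ)) := by
    refine Measurable.stronglyMeasurable ?_
    unfold Function.uncurry
    fun_prop
  exact this.integral_prod_right.measurable

theorem DiskBounded.mul {h : ℂ → ℂ} (hg : DiskBounded m g) (hh : Measurable h)
    (hb : ∀ z, ‖h z‖ ≤ m') : DiskBounded (m * m') (fun z => g z * h z) where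
  meas := hg.meas.mul hh
  bound z := by
    rw [norm_mul]
    exact mul_le_mul (hg.bound z) (hb z) (norm_nonneg _) hg.nonneg
  supp z hz := by simp [hg.supp z hz]

theorem DiskBounded.mul_cauchyT (ha : DiskBounded m a) (hb : DiskBounded m' b) :
    DiskBounded (m * (m' * kernelConst)) (fun z => a z * cauchyT b z) :=
  ha.mul (measurable_cauchyT hb.meas) hb.norm_cauchyT_le

theorem DiskBounded.sub (ha : DiskBounded m a) (hb : DiskBounded m' b) :
    DiskBounded (m + m') (fun z => a z - b z) where
  meas := ha.meas.sub hb.meas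
  bound z := (norm_sub_le _ _).trans (add_le_add (ha.bound z) (hb.bound z))
  supp z hz := by simp [ha.supp z hz, hb.supp z hz]

theorem cauchyT_sub (ha : DiskBounded m a) (hb : DiskBounded m' b) (z : ℂ) :
    cauchyT (fun z => a z - b z) z = cauchyT a z - cauchyT b z := by
  simp only [cauchyT, sub_div]
  exact integral_sub (ha.integrable z) (hb.integrable z)

theorem cauchyT_const_mul (c : ℂ) (z : ℂ) :
    cauchyT (fun z => c * a z) z = c * cauchyT a z := by
  simp only [cauchyT, mul_div_assoc]
  exact integral_const_mul _ _

/-- The kernel of the iterated transform is integrable on the product. -/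
theorem integrable_prod_kernel (ha : DiskBounded m a) (hb : DiskBounded m' b) (z : ℂ) :
    Integrable (Function.uncurry fun ζ ω : ℂ => a ζ / (z - ζ) * (b ω / (ζ - ω)))
      (volume.prod volume) := by
  have ham := ha.meas
  have hbm := hb.meas
  have hmeas : Measurable (Function.uncurry fun ζ ω : ℂ => a ζ / (z - ζ) * (b ω / (ζ - ω))) := by
    unfold Function.uncurry
    fun_prop
  rw [integrable_prod_iff hmeas.aestronglyMeasurable]
  refine ⟨Filter.Eventually.of_forall fun ζ => (hb.integrable ζ).const_mul (a ζ / (z - ζ)), ?_⟩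
  have hn : ∀ ζ, ∫ ω, ‖Function.uncurry (fun ζ ω : ℂ => a ζ / (z - ζ) * (b ω / (ζ - ω))) (ζ, ω)‖
      = ‖a ζ / (z - ζ)‖ * ∫ ω, ‖b ω / (ζ - ω)‖ := by
    intro ζ
    simp only [Function.uncurry, norm_mul]
    exact integral_const_mul _ _
  refine Integrable.mono' ((ha.integrable z).norm.mul_const (m' * kernelConst)) ?_
    (Filter.Eventually.of_forall fun ζ => ?_)
  · exact (hmeas.norm.stronglyMeasurable.integral_prod_right).aestronglyMeasurable
  · rw [hn, norm_mul, norm_norm, Real.norm_of_nonneg (integral_nonneg fun _ => norm_nonneg _)]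
    exact mul_le_mul_of_nonneg_left (hb.integral_norm_le ζ) (norm_nonneg _)

theorem cauchyT_mul_cauchyT (ha : DiskBounded m a) (hb : DiskBounded m' b) (z : ℂ) :
    cauchyT a z * cauchyT b z
      = cauchyT (fun ζ => a ζ * cauchyT b ζ) z + cauchyT (fun ζ => b ζ * cauchyT a ζ) z := by
  have h1 := integrable_prod_kernel ha hb z
  have h2 := integrable_prod_kernel hb ha z
  have e1 : cauchyT (fun ζ => a ζ * cauchyT b ζ) z
      = ∫ ζ, ∫ ω, a ζ / (z - ζ) * (b ω / (ζ - ω)) := by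
    simp only [cauchyT]
    congr 1; ext ζ
    rw [integral_const_mul]; ring
  have e2 : cauchyT (fun ζ => b ζ * cauchyT a ζ) z
      = ∫ ζ, ∫ ω, b ω / (z - ω) * (a ζ / (ω - ζ)) := by
    rw [← integral_integral_swap h2]
    simp only [cauchyT]
    congr 1; ext ζ
    rw [integral_const_mul]; ring
  have e0 : cauchyT a z * cauchyT b z = ∫ ζ, ∫ ω, a ζ / (z - ζ) * (b ω / (z - ω)) := by
    simp only [cauchyT]
    rw [← integral_mul_const]
    congr 1; ext ζ
    rw [integral_const_mul]
  have h3 : Integrable (Function.uncurry fun ζ ω : ℂ => b ω / (z - ω) * (a ζ / (ω - ζ)))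
      (volume.prod volume) := h2.swap
  have i3 : Integrable (fun ζ => ∫ ω, a ζ / (z - ζ) * (b ω / (ζ - ω))) := h1.integral_prod_left
  have i4 : Integrable (fun ζ => ∫ ω, b ω / (z - ω) * (a ζ / (ω - ζ))) := h3.integral_prod_left
  rw [e0, e1, e2, ← integral_add i3 i4]
  refine integral_congr_ae ?_
  have hne : ∀ c : ℂ, ∀ᵐ x : ℂ, x ≠ c := fun c => by
    simp [ae_iff]
  filter_upwards [hne z, h1.prod_right_ae, h3.prod_right_ae] with ζ hζ i1 i2
  simp only [Function.uncurry] at i1 i2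
  rw [← integral_add i1 i2]
  refine integral_congr_ae ?_
  filter_upwards [hne z, hne ζ] with ω hω hωζ
  have q1 : z - ζ ≠ 0 := sub_ne_zero.2 hζ.symm
  have q2 : z - ω ≠ 0 := sub_ne_zero.2 hω.symm
  have q3 : ζ - ω ≠ 0 := sub_ne_zero.2 hωζ.symm
  have q4 : ω - ζ ≠ 0 := sub_ne_zero.2 hωζ
  have q5 : ω - ζ = -(ζ - ω) := by ring
  rw [q5]
  field_simp
  ring

theorem cauchyT_mul_pow (hA : DiskBounded m A) (n : ℕ) (z : ℂ) :
    cauchyT (fun ζ => A ζ * cauchyT A ζ ^ n) z = cauchyT A z ^ (n + 1) / (n + 1) := by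
  induction n generalizing z with
  | zero => simp
  | succ n ih =>
    have hp : DiskBounded (m * (m * kernelConst) ^ n) (fun ζ => A ζ * cauchyT A ζ ^ n) :=
      hA.mul ((measurable_cauchyT hA.meas).pow_const n) fun z => by
        rw [norm_pow]; exact pow_le_pow_left₀ (norm_nonneg _) (hA.norm_cauchyT_le z) n
    have h := cauchyT_mul_cauchyT hp hA z
    rw [ih z] at h
    have e1 : (fun ζ => A ζ * cauchyT A ζ ^ n * cauchyT A ζ)
        = fun ζ => A ζ * cauchyT A ζ ^ (n + 1) := by ext; ring
    have e2 : (fun ζ => A ζ * cauchyT (fun ζ => A ζ * cauchyT A ζ ^ n) ζ)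
        = fun ζ => ((n : ℂ) + 1)⁻¹ * (A ζ * cauchyT A ζ ^ (n + 1)) := by
      ext ζ; rw [ih ζ]; ring
    rw [e1, e2, cauchyT_const_mul] at h
    have hn : (n : ℂ) + 1 ≠ 0 := by exact_mod_cast n.succ_ne_zero
    have hn' : (n : ℂ) + 1 + 1 ≠ 0 := by exact_mod_cast (n + 1).succ_ne_zero
    push_cast
    rw [eq_div_iff hn']
    field_simp at h
    rw [pow_succ (cauchyT A z) (n + 1), h]

theorem DiskBounded.norm_exp_le (hA : DiskBounded m A) (z : ℂ) :
    ‖Complex.exp (-cauchyT A z)‖ ≤ Real.exp (m * kernelConst) := by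
  rw [Complex.norm_exp]
  exact Real.exp_le_exp.2 ((Complex.re_le_norm _).trans (by
    rw [norm_neg]; exact hA.norm_cauchyT_le z))

theorem DiskBounded.mul_exp (hA : DiskBounded m A) (hb : DiskBounded m' b) :
    DiskBounded (m' * Real.exp (m * kernelConst))
      (fun ζ => b ζ * Complex.exp (-cauchyT A ζ)) :=
  hb.mul (by have := measurable_cauchyT hA.meas; fun_prop) hA.norm_exp_le

theorem cauchyT_mul_exp (hA : DiskBounded m A) (z : ℂ) :
    cauchyT (fun ζ => A ζ * Complex.exp (-cauchyT A ζ)) z = 1 - Complex.exp (-cauchyT A z) := by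
  set q := cauchyT A with hq
  have hqm : Measurable q := measurable_cauchyT hA.meas
  have hAm := hA.meas
  set F : ℕ → ℂ → ℂ := fun n ζ => A ζ * ((-q ζ) ^ n / n.factorial) / (z - ζ) with hF
  have hsum : HasSum (fun n => ∫ ζ, F n ζ)
      (∫ ζ, A ζ * Complex.exp (-q ζ) / (z - ζ)) := by
    set B := m * kernelConst
    refine hasSum_integral_of_dominated_convergence
      (fun n ζ => ‖A ζ / (z - ζ)‖ * (B ^ n / n.factorial)) (fun n => ?_) (fun n => ?_) ?_ ?_ ?_
    · exact Measurable.aestronglyMeasurable (by fun_prop)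
    · refine Filter.Eventually.of_forall fun ζ => ?_
      have : F n ζ = A ζ / (z - ζ) * ((-q ζ) ^ n / n.factorial) := by simp only [hF]; ring
      rw [this, norm_mul, norm_div ((-q ζ) ^ n), norm_pow, norm_neg, Complex.norm_natCast]
      gcongr
      exact hA.norm_cauchyT_le ζ
    · exact Filter.Eventually.of_forall fun ζ =>
        (Real.summable_pow_div_factorial B).mul_left _
    · simp_rw [tsum_mul_left]
      exact (hA.integrable z).norm.mul_const _
    · refine Filter.Eventually.of_forall fun ζ => ?_
      have h := (NormedSpace.expSeries_div_hasSum_exp (-q ζ))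
      rw [← Complex.exp_eq_exp_ℂ] at h
      exact (h.mul_left (A ζ)).div_const _
  have hterm : ∀ n : ℕ, ∫ ζ, F n ζ = -((-q z) ^ (n + 1) / ((n + 1).factorial : ℂ)) := by
    intro n
    have h := cauchyT_mul_pow hA n z
    have e : ∫ ζ, F n ζ = (-1) ^ n / (n.factorial : ℂ) *
        cauchyT (fun ζ => A ζ * cauchyT A ζ ^ n) z := by
      rw [cauchyT, ← integral_const_mul]
      congr 1; ext ζ
      simp only [hF, neg_pow (q ζ), ← hq]
      ring
    rw [e, h, Nat.factorial_succ, ← hq, neg_pow (q z)]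
    push_cast
    have hn : (n : ℂ) + 1 ≠ 0 := by exact_mod_cast n.succ_ne_zero
    have hf : (n.factorial : ℂ) ≠ 0 := by exact_mod_cast n.factorial_ne_zero
    field_simp
    ring
  have hexp := (NormedSpace.expSeries_div_hasSum_exp (-q z))
  rw [← Complex.exp_eq_exp_ℂ, ← hasSum_nat_add_iff' 1] at hexp
  have h3 := hexp.neg
  simp only [Finset.range_one, Finset.sum_singleton, pow_zero, Nat.factorial_zero, Nat.cast_one,
    div_one] at h3
  simp_rw [hterm] at hsum
  have := hsum.unique h3
  rw [cauchyT, this]; ring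

/-- The similarity principle: the integrating factor `exp (-cauchyT A)` removes the zeroth order
term `A` from the equation satisfied by `κ + cauchyT g`. -/
theorem exp_mul_add_cauchyT (hA : DiskBounded m A) (hg : DiskBounded m' g) (κ z : ℂ) :
    Complex.exp (-cauchyT A z) * (κ + cauchyT g z)
      = κ + cauchyT (fun ζ => (g ζ - A ζ * (κ + cauchyT g ζ)) * Complex.exp (-cauchyT A ζ)) z := by
  have hE := hA.mul_exp hA
  have hgE := hA.mul_exp hg
  have h1 := cauchyT_mul_cauchyT hE hg z
  rw [cauchyT_mul_exp hA] at h1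
  simp_rw [cauchyT_mul_exp hA] at h1
  have e1 : (fun ζ => (g ζ - A ζ * (κ + cauchyT g ζ)) * Complex.exp (-cauchyT A ζ))
      = fun ζ => (g ζ * Complex.exp (-cauchyT A ζ)
          - κ * (A ζ * Complex.exp (-cauchyT A ζ)))
          - A ζ * Complex.exp (-cauchyT A ζ) * cauchyT g ζ := by
    ext ζ; ring
  have e2 : (fun ζ => g ζ * (1 - Complex.exp (-cauchyT A ζ)))
      = fun ζ => g ζ - g ζ * Complex.exp (-cauchyT A ζ) := by ext ζ; ring
  have hκ : DiskBounded (m * Real.exp (m * kernelConst) * ‖κ‖)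
      fun ζ => κ * (A ζ * Complex.exp (-cauchyT A ζ)) := by
    have := hE.mul (h := fun _ => κ) measurable_const (fun _ => le_rfl)
    simpa only [mul_comm κ] using this
  rw [e2, cauchyT_sub hg hgE] at h1
  rw [e1, cauchyT_sub (hgE.sub hκ) (hE.mul_cauchyT hg), cauchyT_sub hgE hκ, cauchyT_const_mul,
    cauchyT_mul_exp hA]
  linear_combination -h1

end CauchyTransform

section CauchyPompeiu

open MeasureTheory
variable {m m' : ℝ} {g a b A : ℂ → ℂ}

theorem locallyIntegrable_inv : LocallyIntegrable (fun x : ℂ => x⁻¹) := by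
  have h1 : LocallyIntegrable
      (fun x : ℂ => (closedBall (0 : ℂ) 1).indicator (fun x : ℂ => ‖x‖⁻¹) x + 1) :=
    ((integrable_indicator_iff measurableSet_closedBall).2
      integrableOn_inv_norm).locallyIntegrable.add (locallyIntegrable_const 1)
  refine h1.mono (Measurable.aestronglyMeasurable (by fun_prop))
    (Filter.Eventually.of_forall fun x => ?_)
  refine le_trans ?_ (le_abs_self _)
  by_cases hx : x ∈ closedBall (0 : ℂ) 1
  · simp [indicator_of_mem hx]
  · rw [indicator_of_notMem hx, zero_add, norm_inv]
    rw [mem_closedBall_zero_iff, not_le] at hx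
    exact inv_le_one_of_one_le₀ hx.le

theorem DiskBounded.continuous_cauchyT (hg : DiskBounded m g) (hc : Continuous g) :
    Continuous (cauchyT g) := by
  have hs : HasCompactSupport g :=
    HasCompactSupport.intro (isCompact_closedBall (0 : ℂ) 1) hg.supp
  exact hs.continuous_convolution_left (ContinuousLinearMap.mul ℂ ℂ) hc locallyIntegrable_inv

theorem DiskBounded.differentiableOn_cauchyT (hg : DiskBounded m g) {r : ℝ}
    (h0 : ∀ z ∈ ball (0 : ℂ) r, g z = 0) : DifferentiableOn ℂ (cauchyT g) (ball 0 r) := by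
  intro z₀ hz₀
  rw [mem_ball_zero_iff] at hz₀
  set ε := (r - ‖z₀‖) / 2 with hε
  have hεpos : 0 < ε := by rw [hε]; linarith
  have hgm := hg.meas
  have hfar : ∀ z ∈ ball z₀ ε, ∀ ζ, g ζ ≠ 0 → ε ≤ ‖z - ζ‖ := by
    intro z hz ζ hζ
    have h1 : r ≤ ‖ζ‖ := by
      by_contra h
      exact hζ (h0 ζ (mem_ball_zero_iff.2 (not_le.1 h)))
    have h2 : ‖z - z₀‖ < ε := by rwa [mem_ball, dist_eq_norm] at hz
    have h3 : ‖ζ‖ ≤ ‖z - ζ‖ + ‖z - z₀‖ + ‖z₀‖ := by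
      calc ‖ζ‖ = ‖-(z - ζ) + (z - z₀) + z₀‖ := by congr 1; ring
        _ ≤ _ := (norm_add₃_le).trans (by rw [norm_neg])
    rw [hε] at *
    linarith
  have := hasDerivAt_integral_of_dominated_loc_of_deriv_le (𝕜 := ℂ) (μ := volume)
    (F := fun z ζ => g ζ / (z - ζ)) (F' := fun z ζ => -g ζ / (z - ζ) ^ 2) (x₀ := z₀)
    (s := ball z₀ ε) (bound := (closedBall (0 : ℂ) 1).indicator fun _ => m / ε ^ 2)
    (ball_mem_nhds z₀ hεpos)
    (Filter.Eventually.of_forall fun z => Measurable.aestronglyMeasurable (by fun_prop))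
    (hg.integrable z₀) (Measurable.aestronglyMeasurable (by fun_prop))
    (Filter.Eventually.of_forall fun ζ z hz => ?_)
    ((integrable_indicator_iff measurableSet_closedBall).2
      (integrableOn_const measure_closedBall_lt_top.ne))
    (Filter.Eventually.of_forall fun ζ z hz => ?_)
  · exact this.2.differentiableAt.differentiableWithinAt
  · by_cases hζ : g ζ = 0
    · simp only [hζ, neg_zero, zero_div, norm_zero]
      exact indicator_nonneg (fun _ _ => div_nonneg hg.nonneg (sq_nonneg _)) _
    · have hmem : ζ ∈ closedBall (0 : ℂ) 1 := by
        by_contra h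
        exact hζ (hg.supp ζ h)
      rw [indicator_of_mem hmem, norm_div, norm_neg, norm_pow]
      gcongr
      · exact hg.nonneg
      · exact hg.bound ζ
      · exact hfar z hz ζ hζ
  · by_cases hζ : g ζ = 0
    · simp only [hζ, neg_zero, zero_div]
      exact hasDerivAt_const _ _
    · have hne : z - ζ ≠ 0 := norm_pos_iff.1 (hεpos.trans_le (hfar z hz ζ hζ))
      have := (((hasDerivAt_id z).sub_const ζ).inv hne).const_mul (g ζ)
      refine this.congr_deriv ?_
      simp only [id]; ring

/-- The Wirtinger derivative `∂ψ/∂z̄`. -/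
def dbar (ψ : ℂ → ℂ) (z : ℂ) : ℂ := (fderiv ℝ ψ z 1 + I * fderiv ℝ ψ z I) / 2

/-- The unit vector with argument `θ`. -/
def unitVec (θ : ℝ) : ℂ := Real.cos θ + Real.sin θ * I

theorem hasDerivAt_unitVec (θ : ℝ) : HasDerivAt unitVec (I * unitVec θ) θ := by
  have h1 := (Real.hasDerivAt_cos θ).ofReal_comp
  have h2 := ((Real.hasDerivAt_sin θ).ofReal_comp).mul_const I
  have h3 := h1.add h2
  refine h3.congr_deriv ?_
  simp only [unitVec]
  push_cast
  ring_nf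
  rw [I_sq]; ring

theorem continuous_unitVec : Continuous unitVec := by unfold unitVec; fun_prop

theorem unitVec_mul (θ : ℝ) : unitVec θ * (Real.cos θ - Real.sin θ * I) = 1 := by
  have h := Real.sin_sq_add_cos_sq θ
  have h' : (Real.sin θ : ℂ) ^ 2 + (Real.cos θ : ℂ) ^ 2 = 1 := by exact_mod_cast h
  simp only [unitVec]
  ring_nf
  rw [I_sq]; linear_combination h'

theorem dbar_div_unitVec (ψ : ℂ → ℂ) (z : ℂ) (θ : ℝ) :
    dbar ψ z / unitVec θ
      = (fderiv ℝ ψ z (unitVec θ) + I * fderiv ℝ ψ z (I * unitVec θ)) / 2 := by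
  have h1 : unitVec θ = Real.cos θ • (1 : ℂ) + Real.sin θ • I := by simp [unitVec]
  have h2 : I * unitVec θ = (-Real.sin θ) • (1 : ℂ) + Real.cos θ • I := by
    simp only [unitVec, real_smul]; push_cast; ring_nf; rw [I_sq]; ring
  have hne : unitVec θ ≠ 0 := fun h => by simpa [h] using unitVec_mul θ
  rw [div_eq_iff hne]
  have e1 : fderiv ℝ ψ z (unitVec θ)
      = Real.cos θ * fderiv ℝ ψ z 1 + Real.sin θ * fderiv ℝ ψ z I := by
    rw [h1, map_add, map_smul, map_smul]; simp
  have e2 : fderiv ℝ ψ z (I * unitVec θ)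
      = -Real.sin θ * fderiv ℝ ψ z 1 + Real.cos θ * fderiv ℝ ψ z I := by
    rw [h2, map_add, map_smul, map_smul]; simp
  rw [e1, e2, dbar]
  have := unitVec_mul θ
  have hI : I ^ 2 = -1 := I_sq
  linear_combination (-(fderiv ℝ ψ z 1 + I * fderiv ℝ ψ z I) / 2) * this
    - unitVec θ * fderiv ℝ ψ z I * Real.sin θ / 2 * hI

variable {ψ : ℂ → ℂ}

theorem integral_radial (hψ : ContDiff ℝ 1 ψ) (hs : HasCompactSupport ψ) (θ : ℝ) :
    ∫ r in Ioi (0 : ℝ), fderiv ℝ ψ (r * unitVec θ) (unitVec θ) = -ψ 0 := by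
  have hne : unitVec θ ≠ 0 := fun h => by simpa [h] using unitVec_mul θ
  have hd : ∀ r : ℝ, HasDerivAt (fun r : ℝ => ψ (r * unitVec θ))
      (fderiv ℝ ψ (r * unitVec θ) (unitVec θ)) r := by
    intro r
    have h1 : HasDerivAt (fun r : ℝ => (r : ℂ) * unitVec θ) (1 * unitVec θ) r :=
      (hasDerivAt_id r).ofReal_comp.mul_const _
    rw [one_mul] at h1
    exact ((hψ.differentiable one_ne_zero _).hasFDerivAt).comp_hasDerivAt r h1
  have hcont : ContDiff ℝ 1 (fun r : ℝ => ψ (r * unitVec θ)) := by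
    refine hψ.comp ?_
    exact (Complex.ofRealCLM.contDiff).mul contDiff_const
  have hcs : HasCompactSupport (fun r : ℝ => ψ (r * unitVec θ)) := by
    refine hs.comp_isClosedEmbedding (g := fun r : ℝ => (r : ℂ) * unitVec θ) ?_
    exact (Homeomorph.mulRight₀ (unitVec θ) hne).isClosedEmbedding.comp
      Complex.isometry_ofReal.isClosedEmbedding
  have := hcs.integral_Ioi_deriv_eq hcont 0
  simp only [(hd _).deriv, ofReal_zero, zero_mul] at this
  exact this

theorem integral_angular (hψ : ContDiff ℝ 1 ψ) {r : ℝ} (hr : 0 < r) :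
    ∫ θ in Ioo (-Real.pi) Real.pi, fderiv ℝ ψ (r * unitVec θ) (I * unitVec θ) = 0 := by
  have hd : ∀ θ : ℝ, HasDerivAt (fun θ : ℝ => (r : ℂ)⁻¹ * ψ (r * unitVec θ))
      (fderiv ℝ ψ (r * unitVec θ) (I * unitVec θ)) θ := by
    intro θ
    have h1 : HasDerivAt (fun θ : ℝ => (r : ℂ) * unitVec θ) (r • (I * unitVec θ)) θ := by
      rw [real_smul]
      exact (hasDerivAt_unitVec θ).const_mul (r : ℂ)
    have h2 := (((hψ.differentiable one_ne_zero _).hasFDerivAt).comp_hasDerivAt θ h1).const_mul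
      (r : ℂ)⁻¹
    rw [map_smul, real_smul, ← mul_assoc, inv_mul_cancel₀ (by exact_mod_cast hr.ne'), one_mul] at h2
    exact h2
  have hc : Continuous fun θ : ℝ => fderiv ℝ ψ (r * unitVec θ) (I * unitVec θ) := by
    have h1 := hψ.continuous_fderiv one_ne_zero
    have h2 := continuous_unitVec
    fun_prop
  rw [← integral_Ioc_eq_integral_Ioo, ← intervalIntegral.integral_of_le
    (by linarith [Real.pi_pos]), intervalIntegral.integral_eq_sub_of_hasDerivAt
    (fun θ _ => hd θ) (hc.intervalIntegrable _ _)]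
  simp [unitVec]

theorem integrableOn_polar (hψ : ContDiff ℝ 1 ψ) (hs : HasCompactSupport ψ) {e : ℝ → ℂ}
    (he : Continuous e) :
    IntegrableOn (fun p : ℝ × ℝ => fderiv ℝ ψ (p.1 * unitVec p.2) (e p.2))
      (Ioi (0 : ℝ) ×ˢ Ioo (-Real.pi) Real.pi) := by
  have hc : Continuous fun p : ℝ × ℝ => fderiv ℝ ψ (p.1 * unitVec p.2) (e p.2) := by
    have h1 := hψ.continuous_fderiv one_ne_zero
    have h2 := continuous_unitVec
    fun_prop
  obtain ⟨R, hR⟩ := hs.fderiv (𝕜 := ℝ) |>.isCompact.isBounded.subset_closedBall (0 : ℂ)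
  have h1 : IntegrableOn (fun p : ℝ × ℝ => fderiv ℝ ψ (p.1 * unitVec p.2) (e p.2))
      (Icc (0 : ℝ) R ×ˢ Icc (-Real.pi) Real.pi) :=
    hc.continuousOn.integrableOn_compact (isCompact_Icc.prod isCompact_Icc)
  refine IntegrableOn.of_forall_sdiff_eq_zero h1 (measurableSet_Ioi.prod measurableSet_Ioo) ?_
  rintro ⟨r, θ⟩ ⟨⟨hr, hθ⟩, hn⟩
  have hr0 : 0 < r := hr
  have hrR : R < r := by
    by_contra h
    exact hn ⟨⟨hr0.le, not_lt.1 h⟩, Ioo_subset_Icc_self hθ⟩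
  have hnorm : ‖unitVec θ‖ = 1 := by
    have : unitVec θ = Complex.exp (θ * I) := by
      rw [Complex.exp_mul_I]; simp [unitVec]
    rw [this, Complex.norm_exp_ofReal_mul_I]
  have : fderiv ℝ ψ (r * unitVec θ) = 0 := by
    by_contra h
    have := hR (subset_tsupport _ h)
    rw [mem_closedBall_zero_iff, norm_mul, hnorm, mul_one, Complex.norm_real,
      Real.norm_of_nonneg hr0.le] at this
    linarith
  simp [this]

theorem integral_dbar_div (hψ : ContDiff ℝ 1 ψ) (hs : HasCompactSupport ψ) :
    ∫ ξ, dbar ψ ξ / ξ = -Real.pi * ψ 0 := by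
  rw [← Complex.integral_comp_polarCoord_symm]
  set U : ℝ × ℝ → ℂ := fun p => fderiv ℝ ψ (p.1 * unitVec p.2) (unitVec p.2) with hU
  set V : ℝ × ℝ → ℂ := fun p => fderiv ℝ ψ (p.1 * unitVec p.2) (I * unitVec p.2) with hV
  have hUi : IntegrableOn U (Ioi (0 : ℝ) ×ˢ Ioo (-Real.pi) Real.pi) :=
    integrableOn_polar hψ hs continuous_unitVec
  have hVi : IntegrableOn V (Ioi (0 : ℝ) ×ˢ Ioo (-Real.pi) Real.pi) :=
    integrableOn_polar hψ hs (e := fun θ => I * unitVec θ)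
      (continuous_const.mul continuous_unitVec)
  have e1 : ∫ p in polarCoord.target, p.1 • (dbar ψ (Complex.polarCoord.symm p)
        / Complex.polarCoord.symm p)
      = ∫ p in Ioi (0 : ℝ) ×ˢ Ioo (-Real.pi) Real.pi, (1 / 2 * U p + I / 2 * V p) := by
    refine setIntegral_congr_fun (measurableSet_Ioi.prod measurableSet_Ioo) ?_
    rintro ⟨r, θ⟩ ⟨hr, -⟩
    have hr0 : (r : ℂ) ≠ 0 := by exact_mod_cast (show (0 : ℝ) < r from hr).ne'
    have hp : Complex.polarCoord.symm (r, θ) = r * unitVec θ := by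
      rw [Complex.polarCoord_symm_apply]; simp [unitVec]
    have h := dbar_div_unitVec ψ (r * unitVec θ) θ
    simp only [hp, hU, hV, real_smul]
    rw [div_mul_eq_div_div_swap, h]
    field_simp
  have iU : ∫ p in Ioi (0 : ℝ) ×ˢ Ioo (-Real.pi) Real.pi, U p = -(2 * Real.pi) * ψ 0 := by
    have hUi' := hUi
    rw [IntegrableOn, Measure.volume_eq_prod, ← Measure.prod_restrict] at hUi'
    rw [Measure.volume_eq_prod, ← Measure.prod_restrict, integral_prod_symm _ hUi']
    simp only [hU, integral_radial hψ hs]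
    rw [setIntegral_const]
    simp only [Real.volume_real_Ioo_of_le (show -Real.pi ≤ Real.pi by linarith [Real.pi_pos]),
      real_smul]
    push_cast; ring
  have iV : ∫ p in Ioi (0 : ℝ) ×ˢ Ioo (-Real.pi) Real.pi, V p = 0 := by
    rw [Measure.volume_eq_prod] at hVi ⊢
    rw [setIntegral_prod _ hVi]
    exact setIntegral_eq_zero_of_forall_eq_zero fun r hr => integral_angular hψ hr
  rw [e1, integral_add (hUi.const_mul _) (hVi.const_mul _), integral_const_mul, integral_const_mul,
    iU, iV]
  ring

/-- The **Cauchy–Pompeiu formula** for compactly supported functions. -/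
theorem cauchyT_dbar (hψ : ContDiff ℝ 1 ψ) (hs : HasCompactSupport ψ) (z : ℂ) :
    cauchyT (dbar ψ) z = Real.pi * ψ z := by
  have h1 : ContDiff ℝ 1 (fun ξ => ψ (z + ξ)) := hψ.comp (contDiff_const.add contDiff_id)
  have h2 : HasCompactSupport (fun ξ => ψ (z + ξ)) :=
    hs.comp_homeomorph (Homeomorph.addLeft z)
  have h3 := integral_dbar_div h1 h2
  have h4 : ∀ ξ, dbar (fun ξ => ψ (z + ξ)) ξ = dbar ψ (z + ξ) := by
    intro ξ
    simp only [dbar, fderiv_comp_add_left]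
  simp only [h4, add_zero] at h3
  have h5 : ∫ ξ, dbar ψ (z + ξ) / ξ = -cauchyT (dbar ψ) z := by
    rw [cauchyT, ← integral_neg, ← integral_add_left_eq_self (fun ζ => -(dbar ψ ζ / (z - ζ))) z]
    congr 1; ext ξ
    rw [← div_neg]; congr 1; ring
  rw [h5] at h3
  linear_combination -h3

end CauchyPompeiu

section DbarEquation

open MeasureTheory
variable {m L : ℝ} {A d h : ℂ → ℂ}

/-- A map `id - N` with `N` Lipschitz is onto as soon as the maps `id - t • N`, `0 ≤ t ≤ 1`, are
uniformly expanding up to a constant. -/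
theorem surjective_sub_of_lower_bound {X : Type*} [NormedAddCommGroup X] [NormedSpace ℝ X]
    [CompleteSpace X] {N : X → X} {Λ C : ℝ} (hN : ∀ v w, ‖N v - N w‖ ≤ Λ * ‖v - w‖)
    (hC : ∀ t ∈ Icc (0 : ℝ) 1, ∀ v w,
      ‖v - w‖ ≤ C * ‖(v - t • N v) - (w - t • N w)‖) :
    Function.Surjective fun v => v - N v := by
  obtain ⟨n, hn⟩ := exists_nat_gt (2 * |C| * |Λ|)
  have hn0 : (0 : ℝ) < n := lt_of_le_of_lt (by positivity) hn
  have key : ∀ k : ℕ, k ≤ n → Function.Surjective fun v => v - ((k : ℝ) / n) • N v := by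
    intro k
    induction k with
    | zero => intro _ x; exact ⟨x, by simp⟩
    | succ k ih =>
      intro hk y
      have hs := ih (Nat.le_of_succ_le hk)
      have ht : (k : ℝ) / n ∈ Icc (0 : ℝ) 1 :=
        ⟨by positivity, (div_le_one hn0).2 (by exact_mod_cast Nat.le_of_succ_le hk)⟩
      set S := Function.surjInv hs
      have hS : ∀ x, S x - ((k : ℝ) / n) • N (S x) = x := Function.surjInv_eq hs
      have hcon : ContractingWith (1 / 2) fun v => S (y + (1 / (n : ℝ)) • N v) := by
        refine ⟨by rw [← NNReal.coe_lt_coe]; norm_num, LipschitzWith.of_dist_le_mul fun v w => ?_⟩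
        rw [dist_eq_norm, dist_eq_norm]
        have h1 := hC _ ht (S (y + (1 / (n : ℝ)) • N v)) (S (y + (1 / (n : ℝ)) • N w))
        rw [hS, hS, add_sub_add_left_eq_sub, ← smul_sub, norm_smul,
          Real.norm_of_nonneg (by positivity)] at h1
        refine h1.trans ?_
        have h2 := hN v w
        have h3 : ‖N v - N w‖ ≤ |Λ| * ‖v - w‖ :=
          h2.trans (mul_le_mul_of_nonneg_right (le_abs_self _) (norm_nonneg _))
        calc C * (1 / n * ‖N v - N w‖) ≤ |C| * (1 / n * (|Λ| * ‖v - w‖)) := by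
              gcongr; exact le_abs_self _
          _ = (|C| * |Λ| / n) * ‖v - w‖ := by ring
          _ ≤ (1 / 2) * ‖v - w‖ := by
              refine mul_le_mul_of_nonneg_right ?_ (norm_nonneg _)
              rw [div_le_iff₀ hn0]; linarith
          _ = _ := by simp
      have : Nonempty X := ⟨y⟩
      refine ⟨ContractingWith.fixedPoint _ hcon, ?_⟩
      have hfix := hcon.fixedPoint_isFixedPt
      set v := ContractingWith.fixedPoint _ hcon
      have h4 := hS (y + (1 / (n : ℝ)) • N v)
      rw [show S (y + (1 / (n : ℝ)) • N v) = v from hfix] at h4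
      show v - (((k + 1 : ℕ) : ℝ) / n) • N v = y
      rw [Nat.cast_succ, add_div, add_smul, ← sub_sub, h4, add_sub_cancel_right]
  have := key n le_rfl
  simpa [div_self hn0.ne'] using this

theorem exp_mul_eq_const (hA : DiskBounded L A) (hd : Measurable d) (hb : ∀ z, ‖d z‖ ≤ m) {κ : ℂ}
    (h : ∀ z, d z = κ + cauchyT (fun ζ => A ζ * d ζ) z) (z : ℂ) :
    Complex.exp (-cauchyT A z) * d z = κ := by
  have := exp_mul_add_cauchyT hA (hA.mul hd hb) κ z
  simp only [← h, sub_self, zero_mul] at this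
  rw [this]
  simp [cauchyT]

/-- The constant in the a priori estimate `norm_le_of_eq_cauchyT`. -/
def aprioriConst (L : ℝ) : ℝ := 1 + 2 * kernelConst * L * Real.exp (2 * (L * kernelConst))

theorem norm_le_of_eq_cauchyT (hA : DiskBounded L A) (hd : Measurable d) (hb : ∀ z, ‖d z‖ ≤ m)
    (hh : Measurable h) {H : ℝ} (hH : ∀ z, ‖h z‖ ≤ H) {κ : ℂ}
    (he : ∀ z, d z - h z = κ + cauchyT (fun ζ => A ζ * d ζ) z) (h0 : d 0 - h 0 = 0) (z : ℂ) :
    ‖d z‖ ≤ aprioriConst L * H := by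
  have hAh := hA.mul_exp (hA.mul hh hH)
  have key : ∀ z, Complex.exp (-cauchyT A z) * (d z - h z)
      = κ + cauchyT (fun ζ => A ζ * h ζ * Complex.exp (-cauchyT A ζ)) z := by
    intro z
    have := exp_mul_add_cauchyT hA (hA.mul hd hb) κ z
    simp only [← he] at this
    rw [this]
    congr 2; ext ζ; ring
  have hκ := key 0
  rw [h0, mul_zero] at hκ
  set T := L * H * Real.exp (L * kernelConst) * kernelConst with hT
  have h1 := hAh.norm_cauchyT_le 0
  have h2 := hAh.norm_cauchyT_le z
  have h3 : ‖Complex.exp (-cauchyT A z) * (d z - h z)‖ ≤ 2 * T := by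
    rw [key z, eq_neg_of_add_eq_zero_left hκ.symm]
    refine (norm_add_le _ _).trans ?_
    rw [norm_neg]; linarith
  have h4 : ‖d z - h z‖ ≤ Real.exp (L * kernelConst) * (2 * T) := by
    have : d z - h z = Complex.exp (cauchyT A z) * (Complex.exp (-cauchyT A z) * (d z - h z)) := by
      rw [← mul_assoc, ← Complex.exp_add]; simp
    rw [this, norm_mul]
    gcongr
    rw [Complex.norm_exp]
    exact Real.exp_le_exp.2 ((Complex.re_le_norm _).trans (hA.norm_cauchyT_le z))
  have h5 : ‖d z‖ ≤ ‖d z - h z‖ + ‖h z‖ := by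
    simpa using norm_add_le (d z - h z) (h z)
  have h6 := hH z
  have h7 : Real.exp (2 * (L * kernelConst))
      = Real.exp (L * kernelConst) * Real.exp (L * kernelConst) := by
    rw [← Real.exp_add]; ring_nf
  rw [aprioriConst, h7]
  rw [hT] at h4
  linarith

/-- A bounded continuous right-hand side for `∂v/∂z̄ = Φ(z, v)`, Lipschitz in the second variable
and supported over the closed unit disk. -/
structure DbarField (m L : ℝ) (Φ : ℂ → ℂ → ℂ) : Prop where
  cont : Continuous (Function.uncurry Φ)
  bound : ∀ c w, ‖Φ c w‖ ≤ m
  lip : ∀ c w w', ‖Φ c w - Φ c w'‖ ≤ L * ‖w - w'‖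
  supp : ∀ c, c ∉ closedBall (0 : ℂ) 1 → ∀ w, Φ c w = 0

namespace DbarField
variable {Φ : ℂ → ℂ → ℂ} {v w : ℂ → ℂ}

theorem nonneg (hΦ : DbarField m L Φ) : 0 ≤ L := by
  have := (norm_nonneg _).trans (hΦ.lip 0 1 0)
  simpa using this

theorem continuous_comp (hΦ : DbarField m L Φ) (hv : Continuous v) :
    Continuous fun c => Φ c (v c) :=
  hΦ.cont.comp (continuous_id.prodMk hv)

theorem diskBounded (hΦ : DbarField m L Φ) (hv : Continuous v) :
    DiskBounded m fun c => Φ c (v c) where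
  meas := (hΦ.continuous_comp hv).measurable
  bound z := hΦ.bound z _
  supp z hz := hΦ.supp z hz _

/-- The difference quotient of `Φ` along two functions. -/
def quot (Φ : ℂ → ℂ → ℂ) (v w : ℂ → ℂ) (c : ℂ) : ℂ := (Φ c (v c) - Φ c (w c)) / (v c - w c)

theorem quot_mul (Φ : ℂ → ℂ → ℂ) (v w : ℂ → ℂ) (c : ℂ) :
    quot Φ v w c * (v c - w c) = Φ c (v c) - Φ c (w c) := by
  by_cases h : v c = w c
  · simp [h]
  · exact div_mul_cancel₀ _ (sub_ne_zero.2 h)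

theorem diskBounded_quot (hΦ : DbarField m L Φ) (hv : Continuous v) (hw : Continuous w) :
    DiskBounded L (quot Φ v w) where
  meas := ((hΦ.continuous_comp hv).measurable.sub (hΦ.continuous_comp hw).measurable).div
    (hv.measurable.sub hw.measurable)
  bound z := by
    rw [quot, norm_div]
    exact div_le_of_le_mul₀ (norm_nonneg _) hΦ.nonneg (hΦ.lip _ _ _)
  supp z hz := by simp [quot, hΦ.supp z hz]

open BoundedContinuousFunction

/-- The normalised Cauchy transform of `Φ(·, v)`. -/
def solOp (hΦ : DbarField m L Φ) (v : ℂ →ᵇ ℂ) : ℂ →ᵇ ℂ :=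
  BoundedContinuousFunction.ofNormedAddCommGroup
    (fun z => cauchyT (fun c => Φ c (v c)) z - cauchyT (fun c => Φ c (v c)) 0)
    (((hΦ.diskBounded v.continuous).continuous_cauchyT (hΦ.continuous_comp v.continuous)).sub
      continuous_const)
    (m * kernelConst + m * kernelConst) fun z =>
      (norm_sub_le _ _).trans (add_le_add ((hΦ.diskBounded v.continuous).norm_cauchyT_le z)
        ((hΦ.diskBounded v.continuous).norm_cauchyT_le 0))

theorem solOp_apply (hΦ : DbarField m L Φ) (v : ℂ →ᵇ ℂ) (z : ℂ) : hΦ.solOp v z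
    = cauchyT (fun c => Φ c (v c)) z - cauchyT (fun c => Φ c (v c)) 0 := rfl

theorem solOp_sub (hΦ : DbarField m L Φ) (v w : ℂ →ᵇ ℂ) (z : ℂ) : hΦ.solOp v z - hΦ.solOp w z
    = cauchyT (fun c => quot Φ v w c * (v c - w c)) z
      - cauchyT (fun c => quot Φ v w c * (v c - w c)) 0 := by
  simp only [quot_mul, solOp_apply]
  rw [cauchyT_sub (hΦ.diskBounded v.continuous) (hΦ.diskBounded w.continuous),
    cauchyT_sub (hΦ.diskBounded v.continuous) (hΦ.diskBounded w.continuous)]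
  ring

theorem norm_solOp_sub_le (hΦ : DbarField m L Φ) (v w : ℂ →ᵇ ℂ) :
    ‖hΦ.solOp v - hΦ.solOp w‖ ≤ 2 * L * kernelConst * ‖v - w‖ := by
  have hL := hΦ.nonneg
  refine (norm_le (mul_nonneg (mul_nonneg (by linarith) kernelConst_nonneg) (norm_nonneg _))).2
    fun z => ?_
  have hb : DiskBounded (L * ‖v - w‖) (fun c => quot Φ v w c * (v c - w c)) :=
    (hΦ.diskBounded_quot v.continuous w.continuous).mul
      (v.continuous.sub w.continuous).measurable fun z => (v - w).norm_coe_le_norm z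
  rw [BoundedContinuousFunction.sub_apply, solOp_sub]
  refine (norm_sub_le _ _).trans ?_
  have h1 := hb.norm_cauchyT_le z
  have h2 := hb.norm_cauchyT_le 0
  linarith

theorem norm_sub_le_of_solOp (hΦ : DbarField m L Φ) {t : ℝ} (ht : t ∈ Icc (0 : ℝ) 1)
    (v w : ℂ →ᵇ ℂ) :
    ‖v - w‖ ≤ aprioriConst L * ‖(v - t • hΦ.solOp v) - (w - t • hΦ.solOp w)‖ := by
  have hL := hΦ.nonneg
  have hK := kernelConst_nonneg
  have hc : 0 ≤ aprioriConst L := by rw [aprioriConst]; positivity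
  refine (norm_le (mul_nonneg hc (norm_nonneg _))).2 fun z => ?_
  set u := (v - t • hΦ.solOp v) - (w - t • hΦ.solOp w) with hu
  have hA' := hΦ.diskBounded_quot v.continuous w.continuous
  have hA : DiskBounded L (fun c => (t : ℂ) * quot Φ v w c) :=
    ⟨hA'.meas.const_mul _, fun z => by
      rw [norm_mul, Complex.norm_real, Real.norm_of_nonneg ht.1]
      nlinarith [hA'.bound z, ht.2, ht.1, norm_nonneg (quot Φ v w z)],
      fun z hz => by simp [hA'.supp z hz]⟩
  have hval : ∀ z, (v - w) z - u z = t * (hΦ.solOp v z - hΦ.solOp w z) := by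
    intro z
    simp only [hu, BoundedContinuousFunction.sub_apply, BoundedContinuousFunction.smul_apply, real_smul]
    ring
  have hmul : ∀ z, cauchyT (fun c => (t : ℂ) * quot Φ v w c * (v - w) c) z
      = t * cauchyT (fun c => quot Φ v w c * (v c - w c)) z := by
    intro z
    rw [← cauchyT_const_mul]
    simp only [BoundedContinuousFunction.sub_apply, mul_assoc]
  refine norm_le_of_eq_cauchyT hA (v - w).continuous.measurable (v - w).norm_coe_le_norm
    u.continuous.measurable u.norm_coe_le_norm
    (κ := -(t * cauchyT (fun c => quot Φ v w c * (v c - w c)) 0)) (fun z => ?_) ?_ z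
  · rw [hval, solOp_sub, hmul]; ring
  · rw [hval, solOp_sub]; ring

theorem exists_solution (hΦ : DbarField m L Φ) (a : ℂ) :
    ∃ v : ℂ →ᵇ ℂ, ∀ z, v z = a + (cauchyT (fun c => Φ c (v c)) z
      - cauchyT (fun c => Φ c (v c)) 0) := by
  obtain ⟨v, hv⟩ := surjective_sub_of_lower_bound hΦ.norm_solOp_sub_le
    (fun t ht v w => hΦ.norm_sub_le_of_solOp ht v w) (BoundedContinuousFunction.const ℂ a)
  refine ⟨v, fun z => ?_⟩
  have := DFunLike.congr_fun hv z
  simp only [BoundedContinuousFunction.sub_apply, solOp_apply, const_apply] at this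
  linear_combination this

theorem eq_of_eq_at (hΦ : DbarField m L Φ) {v w : ℂ →ᵇ ℂ} {a b : ℂ}
    (hv : ∀ z, v z = a + (cauchyT (fun c => Φ c (v c)) z - cauchyT (fun c => Φ c (v c)) 0))
    (hw : ∀ z, w z = b + (cauchyT (fun c => Φ c (w c)) z - cauchyT (fun c => Φ c (w c)) 0))
    {z₀ : ℂ} (h : v z₀ = w z₀) : v = w := by
  have hA := hΦ.diskBounded_quot v.continuous w.continuous
  have key := exp_mul_eq_const hA (v - w).continuous.measurable (v - w).norm_coe_le_norm
    (κ := a - b - cauchyT (fun c => quot Φ v w c * (v c - w c)) 0) fun z => by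
      have := hΦ.solOp_sub v w z
      simp only [solOp_apply] at this
      simp only [BoundedContinuousFunction.sub_apply]
      rw [hv z, hw z]
      linear_combination this
  have h0 := key z₀
  simp only [BoundedContinuousFunction.sub_apply, h, sub_self, mul_zero] at h0
  rw [← h0] at key
  ext z
  have := (mul_eq_zero.1 (key z)).resolve_left (Complex.exp_ne_zero _)
  exact sub_eq_zero.1 this

end DbarField

end DbarEquation

section FiniteSets

open MeasureTheory

theorem dbar_eq_zero {ψ : ℂ → ℂ} {c : ℂ} (h : DifferentiableAt ℂ ψ c) : dbar ψ c = 0 := by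
  rw [dbar, h.fderiv_restrictScalars ℝ]
  have : fderiv ℂ ψ c I = I * fderiv ℂ ψ c 1 := by
    rw [← smul_eq_mul, ← map_smul]; simp
  simp only [ContinuousLinearMap.coe_restrictScalars', this, ← mul_assoc, I_mul_I]
  ring

theorem dbar_sub_const (ψ : ℂ → ℂ) (a c : ℂ) : dbar (fun z => ψ z - a) c = dbar ψ c := by
  simp only [dbar, fderiv_sub_const]

theorem continuous_dbar {ψ : ℂ → ℂ} (h : ContDiff ℝ 1 ψ) : Continuous (dbar ψ) := by
  have := h.continuous_fderiv one_ne_zero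
  unfold dbar
  fun_prop

/-- The piecewise linear interpolation of the `∂/∂z̄`-derivatives of finitely many functions. -/
def interpField (E : Finset ℂ) (δ : ℝ) (ψ : ℂ → ℂ → ℂ) (c w : ℂ) : ℂ :=
  ∑ i ∈ E, ((max 0 (1 - ‖w - ψ i c‖ / δ) : ℝ) : ℂ) * (dbar (ψ i) c / Real.pi)

theorem interpField_apply {E : Finset ℂ} {δ : ℝ} (hδ : 0 < δ) {ψ : ℂ → ℂ → ℂ}
    (hsep : ∀ i ∈ E, ∀ j ∈ E, i ≠ j → ∀ c, δ ≤ ‖ψ i c - ψ j c‖) {j : ℂ} (hj : j ∈ E) (c : ℂ) :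
    interpField E δ ψ c (ψ j c) = dbar (ψ j) c / Real.pi := by
  rw [interpField, Finset.sum_eq_single_of_mem j hj]
  · simp
  · intro i hi hij
    rw [max_eq_left, ofReal_zero, zero_mul]
    have := hsep j hj i hi hij.symm c
    rw [sub_nonpos, le_div_iff₀ hδ]
    linarith

theorem exists_dbarField_interpField (E : Finset ℂ) {δ : ℝ} (hδ : 0 < δ) {ψ : ℂ → ℂ → ℂ}
    (hψ : ∀ i ∈ E, ContDiff ℝ 1 (ψ i))
    (hsupp : ∀ i ∈ E, ∀ c ∉ closedBall (0 : ℂ) 1, dbar (ψ i) c = 0) :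
    ∃ m L, DbarField m L (interpField E δ ψ) := by
  have hb : ∀ i, ∃ M, i ∈ E → ∀ c, ‖dbar (ψ i) c / Real.pi‖ ≤ M := by
    intro i
    by_cases hi : i ∈ E
    · have hc : HasCompactSupport fun c => dbar (ψ i) c / Real.pi :=
        HasCompactSupport.intro (isCompact_closedBall (0 : ℂ) 1) fun c hc => by
          simp [hsupp i hi c hc]
      obtain ⟨M, hM⟩ := hc.exists_bound_of_continuous ((continuous_dbar (hψ i hi)).div_const _)
      exact ⟨M, fun _ => hM⟩
    · exact ⟨0, fun h => absurd h hi⟩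
  choose M hM using hb
  have hM0 : ∀ i ∈ E, 0 ≤ M i := fun i hi => (norm_nonneg _).trans (hM i hi 0)
  refine ⟨∑ i ∈ E, M i, ∑ i ∈ E, M i / δ, ?_, ?_, ?_, ?_⟩
  · unfold interpField Function.uncurry
    refine continuous_finsetSum _ fun i hi => ?_
    have h1 := (hψ i hi).continuous
    have h2 := continuous_dbar (hψ i hi)
    fun_prop
  · intro c w
    refine (norm_sum_le _ _).trans (Finset.sum_le_sum fun i hi => ?_)
    rw [norm_mul, Complex.norm_real, Real.norm_of_nonneg (le_max_left _ _)]
    have h1 : max 0 (1 - ‖w - ψ i c‖ / δ) ≤ 1 :=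
      max_le zero_le_one (by have : 0 ≤ ‖w - ψ i c‖ / δ := by positivity
                             linarith)
    calc _ ≤ 1 * M i := mul_le_mul h1 (hM i hi c) (norm_nonneg _) zero_le_one
      _ = M i := one_mul _
  · intro c w w'
    rw [interpField, interpField, ← Finset.sum_sub_distrib, Finset.sum_mul]
    refine (norm_sum_le _ _).trans (Finset.sum_le_sum fun i hi => ?_)
    rw [← sub_mul, ← ofReal_sub, norm_mul, Complex.norm_real]
    have h1 : ‖max 0 (1 - ‖w - ψ i c‖ / δ) - max 0 (1 - ‖w' - ψ i c‖ / δ)‖ ≤ ‖w - w'‖ / δ := by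
      refine (abs_max_sub_max_le_max _ _ _ _).trans ?_
      rw [sub_self, abs_zero, max_eq_right (abs_nonneg _)]
      rw [show 1 - ‖w - ψ i c‖ / δ - (1 - ‖w' - ψ i c‖ / δ)
        = (‖w' - ψ i c‖ - ‖w - ψ i c‖) / δ by ring, abs_div, abs_of_pos hδ]
      gcongr
      refine (abs_norm_sub_norm_le _ _).trans ?_
      rw [sub_sub_sub_cancel_right, norm_sub_rev]
    calc _ ≤ ‖w - w'‖ / δ * M i := mul_le_mul h1 (hM i hi c) (norm_nonneg _) (by positivity)
      _ = _ := by ring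
  · intro c hc w
    exact Finset.sum_eq_zero fun i hi => by rw [hsupp i hi c hc]; simp

/-- A compactly supported radial reparametrisation which is the identity on a smaller disk. -/
theorem exists_cutoff {r : ℝ} (h0 : 0 < r) (hr : r < 1) :
    ∃ ρ : ℂ → ℂ, ContDiff ℝ 1 ρ ∧ (∀ c ∈ ball (0 : ℂ) r, ρ c = c) ∧
      (∀ c, c ∉ ball (0 : ℂ) 1 → ρ c = 0) ∧ (∀ c, ρ c ∈ ball (0 : ℂ) 1) ∧ ρ 0 = 0 := by
  let χ : ContDiffBump (0 : ℂ) := ⟨r, (r + 1) / 2, h0, by linarith⟩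
  have hout : ∀ c, c ∉ ball (0 : ℂ) 1 → χ c = 0 := by
    intro c hc
    refine χ.zero_of_le_dist ?_
    rw [mem_ball, not_lt] at hc
    show (r + 1) / 2 ≤ _
    linarith
  refine ⟨fun c => (χ c : ℂ) * c, ?_, fun c hc => ?_, fun c hc => ?_, fun c => ?_, by simp⟩
  · exact (ofRealCLM.contDiff.comp χ.contDiff).mul contDiff_id
  · simp [χ.one_of_mem_closedBall (ball_subset_closedBall hc)]
  · simp only [hout c hc, ofReal_zero, zero_mul]
  · by_cases hc : c ∈ ball (0 : ℂ) 1
    · rw [mem_ball_zero_iff] at hc ⊢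
      rw [norm_mul, Complex.norm_real, Real.norm_of_nonneg χ.nonneg]
      have := χ.le_one (x := c)
      nlinarith [norm_nonneg c, χ.nonneg (x := c)]
    · simp [hout c hc]

/-- Extension of a finite holomorphic motion of points of the plane over a smaller disk. -/
theorem exists_extension_of_finite (E : Finset ℂ) (φ : ℂ → ℂ → ℂ)
    (hd : ∀ z ∈ E, DifferentiableOn ℂ (fun c => φ c z) (ball 0 1))
    (hinj : ∀ c ∈ ball (0 : ℂ) 1, InjOn (φ c) E) (h0 : ∀ z ∈ E, φ 0 z = z)
    {r : ℝ} (hr0 : 0 < r) (hr : r < 1) :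
    ∃ Ψ : ℂ → ℂ → ℂ, (∀ a, DifferentiableOn ℂ (fun c => Ψ c a) (ball 0 r)) ∧
      (∀ c, Function.Injective (Ψ c)) ∧ (∀ a, Ψ 0 a = a) ∧
      ∀ c ∈ ball (0 : ℂ) r, ∀ z ∈ E, Ψ c z = φ c z := by
  obtain ⟨ρ, hρ, hρid, hρout, hρball, hρ0⟩ := exists_cutoff hr0 hr
  set ψ : ℂ → ℂ → ℂ := fun i c => φ (ρ c) i with hψdef
  have hψ : ∀ i ∈ E, ContDiff ℝ 1 (ψ i) := by
    intro i hi
    rw [contDiff_iff_contDiffAt]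
    intro c
    have h1 : ContDiffAt ℂ 1 (fun c => φ c i) (ρ c) :=
      ((hd i hi).contDiffOn isOpen_ball).contDiffAt (isOpen_ball.mem_nhds (hρball c))
    exact (h1.restrict_scalars ℝ).comp c hρ.contDiffAt
  have hψ0 : ∀ i ∈ E, ψ i 0 = i := fun i hi => by simp only [hψdef, hρ0, h0 i hi]
  have hψout : ∀ i ∈ E, ∀ c ∉ ball (0 : ℂ) 1, ψ i c = i := fun i hi c hc => by
    simp only [hψdef, hρout c hc, h0 i hi]
  have hψr : ∀ i ∈ E, ∀ c ∈ ball (0 : ℂ) r, dbar (ψ i) c = 0 := by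
    intro i hi c hc
    refine dbar_eq_zero ?_
    have h1 : DifferentiableAt ℂ (fun c => φ c i) c :=
      (hd i hi).differentiableAt (isOpen_ball.mem_nhds (ball_subset_ball hr.le hc))
    refine h1.congr_of_eventuallyEq ?_
    filter_upwards [isOpen_ball.mem_nhds hc] with x hx
    simp only [hψdef, hρid x hx]
  have hsupp : ∀ i ∈ E, ∀ c ∉ closedBall (0 : ℂ) 1, dbar (ψ i) c = 0 := by
    intro i hi c hc
    refine dbar_eq_zero ?_
    refine (differentiableAt_const i).congr_of_eventuallyEq ?_
    filter_upwards [isClosed_closedBall.isOpen_compl.mem_nhds hc] with x hx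
    exact hψout i hi x fun h => hx (ball_subset_closedBall h)
  obtain ⟨δ, hδ, hsep⟩ : ∃ δ : ℝ, 0 < δ ∧
      ∀ i ∈ E, ∀ j ∈ E, i ≠ j → ∀ c, δ ≤ ‖ψ i c - ψ j c‖ := by
    have hpair : ∀ i ∈ E, ∀ j ∈ E, i ≠ j →
        ∃ δ : ℝ, 0 < δ ∧ ∀ c, δ ≤ ‖ψ i c - ψ j c‖ := by
      intro i hi j hj hij
      have hc : Continuous fun c => ‖ψ i c - ψ j c‖ :=
        ((hψ i hi).continuous.sub (hψ j hj).continuous).norm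
      obtain ⟨c₀, -, hc₀⟩ := (isCompact_closedBall (0 : ℂ) 1).exists_isMinOn
        ⟨0, by simp⟩ hc.continuousOn
      refine ⟨_, norm_pos_iff.2 (sub_ne_zero.2 fun h =>
        hij (hinj (ρ c₀) (hρball c₀) hi hj h)), fun c => ?_⟩
      by_cases hcb : c ∈ closedBall (0 : ℂ) 1
      · exact hc₀ hcb
      · have h1 : c ∉ ball (0 : ℂ) 1 := fun h => hcb (ball_subset_closedBall h)
        have h2 := hc₀ (show (0 : ℂ) ∈ closedBall (0 : ℂ) 1 by simp)
        change ‖ψ i c₀ - ψ j c₀‖ ≤ ‖ψ i 0 - ψ j 0‖ at h2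
        rw [hψ0 i hi, hψ0 j hj] at h2
        rwa [hψout i hi c h1, hψout j hj c h1]
    have hev : ∀ᶠ δ : ℝ in nhdsWithin 0 (Ioi 0), ∀ i ∈ E, ∀ j ∈ E, i ≠ j →
        ∀ c, δ ≤ ‖ψ i c - ψ j c‖ := by
      refine (Filter.eventually_all_finset E).2 fun i hi =>
        (Filter.eventually_all_finset E).2 fun j hj => ?_
      by_cases hij : i = j
      · simp [hij]
      · obtain ⟨δ, hδ, h⟩ := hpair i hi j hj hij
        filter_upwards [Ioc_mem_nhdsGT hδ] with x hx _ c
        exact hx.2.trans (h c)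
    obtain ⟨δ, h1, h2⟩ := (hev.and self_mem_nhdsWithin).exists
    exact ⟨δ, h2, h1⟩
  obtain ⟨m, L, hΦ⟩ := exists_dbarField_interpField E hδ hψ hsupp
  choose v hv using hΦ.exists_solution
  have hv0 : ∀ a, v a 0 = a := fun a => by rw [hv a 0]; ring
  have hvψ : ∀ i ∈ E, ∀ c, v i c = ψ i c := by
    intro i hi
    have hcs : HasCompactSupport fun c => ψ i c - i :=
      HasCompactSupport.intro (isCompact_closedBall (0 : ℂ) 1) fun c hc => by
        rw [hψout i hi c fun h => hc (ball_subset_closedBall h), sub_self]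
    have hcd : ContDiff ℝ 1 fun c => ψ i c - i := (hψ i hi).sub contDiff_const
    obtain ⟨M, hM⟩ := hcs.exists_bound_of_continuous hcd.continuous
    let w : BoundedContinuousFunction ℂ ℂ := BoundedContinuousFunction.ofNormedAddCommGroup (ψ i)
      (hψ i hi).continuous (M + ‖i‖) fun c => by
        have := norm_add_le (ψ i c - i) i
        rw [sub_add_cancel] at this
        linarith [hM c]
    have hw : ∀ c, w c = ψ i c := fun _ => rfl
    have hcT : ∀ z, cauchyT (fun c => interpField E δ ψ c (w c)) z = ψ i z - i := by
      intro z
      have h1 : (fun c => interpField E δ ψ c (w c))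
          = fun c => (Real.pi : ℂ)⁻¹ * dbar (fun c => ψ i c - i) c := by
        ext c
        rw [hw, interpField_apply hδ hsep hi, dbar_sub_const, div_eq_inv_mul]
      rw [h1, cauchyT_const_mul, cauchyT_dbar hcd hcs, inv_mul_cancel_left₀]
      exact_mod_cast Real.pi_ne_zero
    have hwsol : ∀ z, w z = i + (cauchyT (fun c => interpField E δ ψ c (w c)) z
        - cauchyT (fun c => interpField E δ ψ c (w c)) 0) := by
      intro z
      rw [hcT, hcT, hψ0 i hi, hw]; ring
    have := hΦ.eq_of_eq_at (hv i) hwsol (z₀ := 0) (by rw [hv0, hw, hψ0 i hi])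
    intro c
    rw [this, hw]
  refine ⟨fun c a => v a c, fun a => ?_, fun c a b hab => ?_, hv0, fun c hc z hz => ?_⟩
  · have hg := hΦ.diskBounded (v a).continuous
    have h1 := hg.differentiableOn_cauchyT (r := r) fun c hc =>
      Finset.sum_eq_zero fun i hi => by rw [hψr i hi c hc]; simp
    refine ((h1.sub_const _).const_add a).congr fun c _ => hv a c
  · have := hΦ.eq_of_eq_at (hv a) (hv b) hab
    rw [← hv0 a, this, hv0]
  · show v z c = _
    rw [hvψ z hz]
    simp only [hψdef, hρid c hc]

end FiniteSets

section Schottky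

open MeasureTheory
variable {r R s : ℝ} {h k g : ℂ → ℂ}

theorem exists_log (hr : 0 < r) (hd : DifferentiableOn ℂ h (ball 0 r))
    (hne : ∀ z ∈ ball (0 : ℂ) r, h z ≠ 0) :
    ∃ l : ℂ → ℂ, DifferentiableOn ℂ l (ball 0 r) ∧ (∀ z ∈ ball (0 : ℂ) r, Complex.exp (l z) = h z) ∧
      l 0 = Complex.log (h 0) := by
  have h0 : (0 : ℂ) ∈ ball (0 : ℂ) r := mem_ball_self hr
  have hq : DifferentiableOn ℂ (fun z => deriv h z / h z) (ball 0 r) :=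
    (hd.deriv isOpen_ball).div hd hne
  obtain ⟨l, hl0, hl⟩ := hq.isExactOn_ball.with_val_at 0 (Complex.log (h 0))
  refine ⟨l, fun z hz => (hl z hz).differentiableAt.differentiableWithinAt, ?_, hl0⟩
  have hder : ∀ z ∈ ball (0 : ℂ) r, HasDerivAt (fun z => h z * Complex.exp (-l z)) 0 z := by
    intro z hz
    have h1 := (hd.differentiableAt (isOpen_ball.mem_nhds hz)).hasDerivAt
    have h2 := ((hl z hz).neg).cexp
    refine (h1.mul h2).congr_deriv ?_
    have := hne z hz
    field_simp
    simp
  intro z hz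
  have hconst := (convex_ball (0 : ℂ) r).is_const_of_fderivWithin_eq_zero (𝕜 := ℂ)
    (fun z hz => (hder z hz).differentiableAt.differentiableWithinAt)
    (fun z hz => by
      rw [fderivWithin_of_isOpen isOpen_ball hz]
      ext
      simpa using (hder z hz).deriv) hz h0
  simp only [hl0, Complex.exp_neg, Complex.exp_log (hne 0 h0), mul_inv_cancel₀ (hne 0 h0)] at hconst
  rw [mul_inv_eq_one₀ (Complex.exp_ne_zero _)] at hconst
  exact hconst.symm

theorem exists_sqrt (hr : 0 < r) (hd : DifferentiableOn ℂ h (ball 0 r))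
    (hne : ∀ z ∈ ball (0 : ℂ) r, h z ≠ 0) :
    ∃ q : ℂ → ℂ, DifferentiableOn ℂ q (ball 0 r) ∧ (∀ z ∈ ball (0 : ℂ) r, q z ^ 2 = h z) ∧
      q 0 = Complex.exp (Complex.log (h 0) / 2) := by
  obtain ⟨l, hld, hle, hl0⟩ := exists_log hr hd hne
  refine ⟨fun z => Complex.exp (l z / 2), (hld.div_const 2).cexp, fun z hz => ?_, by
    simp only [hl0]⟩
  rw [← hle z hz, ← Complex.exp_nat_mul]
  congr 1; push_cast; ring

/-- A form of **Bloch's theorem**. -/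
theorem norm_deriv_mul_le_of_forall_exists_notMem {ρ : ℝ} (hk : DifferentiableOn ℂ k (ball 0 R))
    (hρ : ∀ w, ∃ p ∈ ball w ρ, p ∉ k '' ball 0 R) {z : ℂ} (hz : z ∈ ball (0 : ℂ) R) :
    ‖deriv k z‖ * (R - ‖z‖) ≤ 48 * ρ := by
  have hkd : DifferentiableOn ℂ (deriv k) (ball 0 R) := hk.deriv isOpen_ball
  have hρ0 : 0 < ρ := by
    obtain ⟨p, hp, -⟩ := hρ 0
    exact pos_of_mem_ball hp
  have key : ∀ r, ‖z‖ < r → r < R → ‖deriv k z‖ * (r - ‖z‖) ≤ 48 * ρ := by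
    intro r hzr hrR
    have hsub : closedBall (0 : ℂ) r ⊆ ball 0 R := closedBall_subset_ball hrR
    have hcont : ContinuousOn (fun z => ‖deriv k z‖ * (r - ‖z‖)) (closedBall 0 r) :=
      ((hkd.continuousOn.mono hsub).norm).mul (by fun_prop)
    obtain ⟨z₀, hz₀, hmax⟩ := (isCompact_closedBall (0 : ℂ) r).exists_isMaxOn
      ⟨z, by simpa using hzr.le⟩ hcont
    have hzmax : ‖deriv k z‖ * (r - ‖z‖) ≤ ‖deriv k z₀‖ * (r - ‖z₀‖) :=
      hmax (by simpa using hzr.le)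
    refine hzmax.trans ?_
    rw [mem_closedBall_zero_iff] at hz₀
    set M := ‖deriv k z₀‖ with hM
    by_contra! hcon
    have hprod : 0 < M * (r - ‖z₀‖) := lt_trans (by positivity) hcon
    have hM0 : 0 < M := by
      refine (norm_nonneg _).lt_of_ne' fun h => ?_
      rw [← hM] at h
      simp [h] at hprod
    have ht0 : 0 < r - ‖z₀‖ := (mul_pos_iff_of_pos_left hM0).1 hprod
    set t := (r - ‖z₀‖) / 2 with ht
    have htpos : 0 < t := by linarith
    have hnear : ∀ x ∈ ball z₀ t, ‖x‖ + t < r := by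
      intro x hx
      rw [mem_ball, dist_eq_norm] at hx
      have := norm_le_norm_add_norm_sub' x z₀
      linarith
    have hsub2 : ball z₀ t ⊆ ball 0 R := fun x hx => by
      rw [mem_ball_zero_iff]; linarith [hnear x hx]
    have hk2 : ∀ x ∈ ball z₀ t, ‖deriv k x‖ ≤ 2 * M := by
      intro x hx
      have h1 : ‖deriv k x‖ * (r - ‖x‖) ≤ M * (r - ‖z₀‖) :=
        hmax (by rw [mem_closedBall_zero_iff]; linarith [hnear x hx])
      have h2 := hnear x hx
      have h3 : ‖deriv k x‖ * t ≤ M * (2 * t) := by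
        refine le_trans ?_ (h1.trans_eq (by rw [ht]; ring))
        gcongr
        linarith
      nlinarith
    have hz₀t : z₀ ∈ ball z₀ t := mem_ball_self htpos
    have hschwarz : ∀ x ∈ ball z₀ t, ‖deriv k x - deriv k z₀‖ ≤ 3 * M / t * ‖x - z₀‖ := by
      intro x hx
      have := Complex.dist_le_div_mul_dist_of_mapsTo_ball (R₂ := 3 * M) (hkd.mono hsub2)
        (fun y hy => by
          rw [mem_closedBall, dist_eq_norm]
          refine (norm_sub_le _ _).trans ?_
          linarith [hk2 y hy]) hx
      rwa [dist_eq_norm, dist_eq_norm] at this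
    have hsub3 : closedBall z₀ (t / 6) ⊆ ball z₀ t := closedBall_subset_ball (by linarith)
    have hlow : ∀ x ∈ closedBall z₀ (t / 6), M / 2 * ‖x - z₀‖ ≤ ‖k x - k z₀‖ := by
      intro x hx
      have h1 := (convex_closedBall z₀ (t / 6)).norm_image_sub_le_of_norm_hasDerivWithin_le
        (𝕜 := ℂ) (f := fun x => k x - deriv k z₀ * x) (f' := fun x => deriv k x - deriv k z₀)
        (C := M / 2) (fun y hy => by
          have h2 := (hk.differentiableAt
            (isOpen_ball.mem_nhds (hsub2 (hsub3 hy)))).hasDerivAt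
          have h3 := h2.sub ((hasDerivAt_id y).const_mul (deriv k z₀))
          rw [mul_one] at h3
          exact h3.hasDerivWithinAt)
        (fun y hy => by
          refine (hschwarz y (hsub3 hy)).trans ?_
          rw [mem_closedBall, dist_eq_norm] at hy
          calc 3 * M / t * ‖y - z₀‖ ≤ 3 * M / t * (t / 6) := by gcongr
            _ = M / 2 := by field_simp; norm_num)
        (mem_closedBall_self (by positivity)) hx
      have h2 : deriv k z₀ * (x - z₀) = (k x - k z₀)
          - ((k x - deriv k z₀ * x) - (k z₀ - deriv k z₀ * z₀)) := by ring
      have h3 : M * ‖x - z₀‖ ≤ ‖k x - k z₀‖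
          + ‖(k x - deriv k z₀ * x) - (k z₀ - deriv k z₀ * z₀)‖ := by
        rw [hM, ← norm_mul, h2]
        exact norm_sub_le _ _
      linarith
    have himg := DiffContOnCl.ball_subset_image_closedBall (f := k) (z₀ := z₀) (r := t / 6)
      (ε := M / 2 * (t / 6))
      (hk.mono (by
        rw [closure_ball z₀ (by positivity)]; exact hsub3.trans hsub2)).diffContOnCl
      (by positivity)
      (fun x hx => by
        have := hlow x (sphere_subset_closedBall hx)
        rwa [mem_sphere_iff_norm.1 hx] at this)
      (by
        have h1 : ∃ᶠ x in nhdsWithin z₀ {z₀}ᶜ, x ∈ closedBall z₀ (t / 6) :=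
          Filter.Eventually.frequently
            (nhdsWithin_le_nhds (closedBall_mem_nhds z₀ (by positivity)))
        have h2 : ∃ᶠ x in nhdsWithin z₀ {z₀}ᶜ, k x ≠ k z₀ := by
          refine (h1.and_eventually self_mem_nhdsWithin).mono fun x hx heq => ?_
          have h3 := hlow x hx.1
          rw [heq, sub_self, norm_zero] at h3
          have h4 : 0 < ‖x - z₀‖ := norm_pos_iff.2 (sub_ne_zero.2 hx.2)
          nlinarith
        exact h2.filter_mono nhdsWithin_le_nhds)
    obtain ⟨p, hp, hpk⟩ := hρ (k z₀)
    have hlt : ρ ≤ M / 2 * (t / 6) / 2 := by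
      have : M * (r - ‖z₀‖) = M * (2 * t) := by rw [ht]; ring
      rw [this] at hcon
      linarith
    obtain ⟨x, hx, hxp⟩ := himg (ball_subset_ball hlt hp)
    exact hpk ⟨x, hsub2 (hsub3 hx), hxp⟩
  rw [mem_ball_zero_iff] at hz
  have hlim : Filter.Tendsto (fun r => ‖deriv k z‖ * (r - ‖z‖)) (nhdsWithin R (Iio R))
      (nhds (‖deriv k z‖ * (R - ‖z‖))) :=
    ((Continuous.tendsto (by fun_prop) R).mono_left nhdsWithin_le_nhds)
  refine le_of_tendsto hlim ?_
  filter_upwards [Ioo_mem_nhdsLT hz] with r hr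
  exact key r hr.1 hr.2

theorem exists_cosh_sq_eq_nat (w : ℂ) : ∃ p ∈ ball w 4, ∃ n : ℕ, Complex.cosh p ^ 2 = n := by
  obtain ⟨x, hx, n, hn⟩ : ∃ x : ℝ, |x - w.re| ≤ 2 ∧ ∃ n : ℕ, Real.cosh x ^ 2 = n := by
    set u := |w.re| with hu
    have hu0 : 0 ≤ u := abs_nonneg _
    have hc1 := Real.one_le_cosh u
    set n := ⌈Real.cosh u ^ 2⌉₊ with hn
    have hn1 : Real.cosh u ^ 2 ≤ n := Nat.le_ceil _
    have hn2 : (n : ℝ) < Real.cosh u ^ 2 + 1 := Nat.ceil_lt_add_one (by positivity)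
    have hs1 : Real.cosh u ≤ √n := Real.le_sqrt_of_sq_le hn1
    have hs2 : √n ≤ Real.cosh u + 1 := Real.sqrt_le_iff.2 ⟨by positivity, by nlinarith⟩
    have hcosh2 : 2 ≤ Real.cosh 2 := by
      have h1 : Real.cosh 2 = 2 * Real.cosh 1 ^ 2 - 1 := by
        rw [show (2 : ℝ) = 2 * 1 by norm_num, Real.cosh_two_mul, mul_one]
        have := Real.cosh_sq 1
        linarith
      have h2 : (1.35 : ℝ) ≤ Real.cosh 1 := by
        rw [Real.cosh_eq]
        have := Real.exp_one_gt_d9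
        have := Real.exp_pos (-1)
        linarith
      nlinarith
    have hs3 : Real.cosh u + 1 ≤ Real.cosh (u + 2) := by
      rw [Real.cosh_add]
      have h1 : 0 ≤ Real.sinh u := Real.sinh_nonneg_iff.2 hu0
      have h2 : 0 ≤ Real.sinh 2 := Real.sinh_nonneg_iff.2 (by norm_num)
      nlinarith [mul_nonneg h1 h2]
    have hp : 0 < √n := by linarith
    set x := Real.arcosh √n with hx
    have hx1 : u ≤ x := by
      rw [← Real.arcosh_cosh hu0]
      exact (Real.arcosh_le_arcosh (by linarith) hp).2 hs1
    have hx2 : x ≤ u + 2 := by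
      rw [← Real.arcosh_cosh (show 0 ≤ u + 2 by linarith)]
      exact (Real.arcosh_le_arcosh hp (by linarith)).2 (hs2.trans hs3)
    have hcx : Real.cosh x ^ 2 = n := by
      rw [hx, Real.cosh_arcosh (by linarith), Real.sq_sqrt (by positivity)]
    rcases le_total 0 w.re with h | h
    · rw [abs_of_nonneg h] at hu
      exact ⟨x, abs_le.2 ⟨by linarith, by linarith⟩, n, hcx⟩
    · rw [abs_of_nonpos h] at hu
      exact ⟨-x, abs_le.2 ⟨by linarith, by linarith⟩, n, by rw [Real.cosh_neg, hcx]⟩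
  set m := round (w.im / Real.pi) with hm
  have hy : |m * Real.pi - w.im| ≤ Real.pi / 2 := by
    have h1 := abs_sub_round (w.im / Real.pi)
    have h2 : (m : ℝ) * Real.pi - w.im = -(w.im / Real.pi - m) * Real.pi := by
      field_simp; ring
    rw [h2, abs_mul, abs_neg, abs_of_pos Real.pi_pos]
    nlinarith [Real.pi_pos]
  refine ⟨x + m * Real.pi * I, ?_, n, ?_⟩
  · rw [mem_ball, dist_eq_norm]
    refine (Complex.norm_le_abs_re_add_abs_im _).trans_lt ?_
    have e1 : (x + m * Real.pi * I - w : ℂ).re = x - w.re := by simp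
    have e2 : (x + m * Real.pi * I - w : ℂ).im = m * Real.pi - w.im := by simp
    rw [e1, e2]
    linarith [Real.pi_lt_four]
  · have hsin : Complex.sin (m * Real.pi) = 0 := Complex.sin_int_mul_pi m
    have hcos : Complex.cos (m * Real.pi) ^ 2 = 1 := by
      have := Complex.sin_sq_add_cos_sq (m * Real.pi)
      rw [hsin] at this
      simpa using this
    rw [Complex.cosh_add, Complex.cosh_mul_I, Complex.sinh_mul_I, hsin, zero_mul, mul_zero,
      add_zero, mul_pow, hcos, mul_one, ← Complex.ofReal_cosh]
    exact_mod_cast hn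

theorem norm_cosh_le (w : ℂ) : ‖Complex.cosh w‖ ≤ Real.exp ‖w‖ := by
  have h1 : ‖Complex.exp w‖ ≤ Real.exp ‖w‖ := Complex.norm_exp_le_exp_norm w
  have h2 : ‖Complex.exp (-w)‖ ≤ Real.exp ‖w‖ := by
    simpa using Complex.norm_exp_le_exp_norm (-w)
  rw [Complex.cosh, norm_div, Complex.norm_ofNat]
  have := norm_add_le (Complex.exp w) (Complex.exp (-w))
  linarith

/-- **Schottky's theorem**, without an explicit constant. -/
theorem exists_schottky_bound (hs : 0 ≤ s) (hsR : s < R) (a : ℂ) :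
    ∃ M : ℝ, ∀ g : ℂ → ℂ, DifferentiableOn ℂ g (ball 0 R) →
      (∀ z ∈ ball (0 : ℂ) R, g z ≠ 0 ∧ g z ≠ 1) → g 0 = a →
      ∀ z ∈ closedBall (0 : ℂ) s, ‖g z‖ ≤ M := by
  have hR : 0 < R := hs.trans_lt hsR
  set F₀ := Complex.log a / (2 * Real.pi * I) with hF₀
  set G₀ := Complex.exp (Complex.log F₀ / 2) with hG₀
  set H₀ := Complex.exp (Complex.log (F₀ - 1) / 2) with hH₀
  set k₀ := Complex.log (G₀ - H₀) with hk₀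
  set K := ‖k₀‖ + 192 / (R - s) * s with hK
  refine ⟨Real.exp (2 * Real.pi * Real.exp K ^ 2), fun g hg hav hg0 z hz => ?_⟩
  have hpi : (2 * Real.pi * I : ℂ) ≠ 0 := Complex.two_pi_I_ne_zero
  obtain ⟨l, hld, hle, hl0⟩ := exists_log hR hg fun z hz => (hav z hz).1
  set F : ℂ → ℂ := fun z => l z / (2 * Real.pi * I) with hF
  have hFd : DifferentiableOn ℂ F (ball 0 R) := hld.div_const _
  have hgF : ∀ z ∈ ball (0 : ℂ) R, Complex.exp (F z * (2 * Real.pi * I)) = g z := fun z hz => by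
    rw [hF]; simp only [div_mul_cancel₀ _ hpi, hle z hz]
  have hFint : ∀ z ∈ ball (0 : ℂ) R, ∀ n : ℕ, F z ≠ n := fun z hz n h => by
    refine (hav z hz).2 ?_
    rw [← hgF z hz, h]
    exact Complex.exp_nat_mul_two_pi_mul_I n
  obtain ⟨G, hGd, hG2, hG0⟩ := exists_sqrt hR hFd fun z hz => by simpa using hFint z hz 0
  obtain ⟨H, hHd, hH2, hH0⟩ := exists_sqrt hR (hFd.sub_const 1) fun z hz => by
    simpa [sub_eq_zero] using hFint z hz 1
  have hGH : ∀ z ∈ ball (0 : ℂ) R, (G z - H z) * (G z + H z) = 1 := fun z hz => by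
    linear_combination hG2 z hz - hH2 z hz
  obtain ⟨k, hkd, hke, hk0⟩ := exists_log hR (hGd.sub hHd) fun z hz =>
    left_ne_zero_of_mul_eq_one (hGH z hz)
  have hcosh : ∀ z ∈ ball (0 : ℂ) R, F z = Complex.cosh (k z) ^ 2 := by
    intro z hz
    have h1 := hGH z hz
    have h2 : Complex.exp (-k z) = G z + H z := by
      rw [Complex.exp_neg, hke z hz]
      exact inv_eq_of_mul_eq_one_right h1
    rw [Complex.cosh, h2, hke z hz, ← hG2 z hz]
    simp only [Pi.sub_apply]
    ring
  have hρ : ∀ w, ∃ p ∈ ball w 4, p ∉ k '' ball 0 R := by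
    intro w
    obtain ⟨p, hp, n, hn⟩ := exists_cosh_sq_eq_nat w
    refine ⟨p, hp, ?_⟩
    rintro ⟨x, hx, rfl⟩
    exact hFint x hx n (by rw [hcosh x hx, hn])
  have hk00 : k 0 = k₀ := by
    rw [hk0, Pi.sub_apply, hG0, hH0]
    simp only [hF, hl0, hg0, hk₀, hG₀, hH₀, hF₀]
  have hkK : ‖k z‖ ≤ K := by
    have h1 := (convex_closedBall (0 : ℂ) s).norm_image_sub_le_of_norm_deriv_le (𝕜 := ℂ) (f := k)
      (C := 192 / (R - s)) (fun x hx => hkd.differentiableAt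
        (isOpen_ball.mem_nhds (closedBall_subset_ball hsR hx)))
      (fun x hx => by
        have h2 := norm_deriv_mul_le_of_forall_exists_notMem hkd hρ
          (closedBall_subset_ball hsR hx)
        rw [mem_closedBall_zero_iff] at hx
        rw [le_div_iff₀ (by linarith)]
        have : ‖deriv k x‖ * (R - s) ≤ ‖deriv k x‖ * (R - ‖x‖) := by gcongr
        linarith)
      (mem_closedBall_self hs) hz
    rw [sub_zero, hk00] at h1
    rw [mem_closedBall_zero_iff] at hz
    have h2 : 192 / (R - s) * ‖z‖ ≤ 192 / (R - s) * s := by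
      have : 0 < R - s := by linarith
      gcongr
    have h3 := norm_le_norm_add_norm_sub' (k z) k₀
    linarith
  have hzR := closedBall_subset_ball hsR hz
  rw [← hgF z hzR]
  refine (Complex.norm_exp_le_exp_norm _).trans (Real.exp_le_exp.2 ?_)
  rw [hcosh z hzR, norm_mul, norm_pow]
  have h1 : ‖(2 * Real.pi * I : ℂ)‖ = 2 * Real.pi := by
    simp [abs_of_pos Real.pi_pos]
  rw [h1, mul_comm]
  gcongr
  exact (norm_cosh_le _).trans (Real.exp_le_exp.2 hkK)

/-- A quantitative form of **Hurwitz's theorem**. -/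
theorem exists_lower_bound_of_ne_zero (M : ℝ) {c : ℂ} {z : ℂ}
    (hz : z ∈ ball (0 : ℂ) R) :
    ∃ m : ℝ, 0 < m ∧ ∀ h : ℂ → ℂ, DifferentiableOn ℂ h (ball 0 R) →
      (∀ z ∈ ball (0 : ℂ) R, h z ≠ 0) → (∀ z ∈ ball (0 : ℂ) R, ‖h z‖ ≤ M) → h 0 = c →
      m ≤ ‖h z‖ := by
  have hR : 0 < R := pos_of_mem_ball hz
  set M' := Real.log (max M 2) with hM'
  have hM0 : 0 < M' := Real.log_pos (lt_of_lt_of_le one_lt_two (le_max_right _ _))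
  refine ⟨Real.exp (-(2 * M' * ‖z‖ / (R - ‖z‖)
    + ‖Complex.log c‖ * (R + ‖z‖) / (R - ‖z‖))), Real.exp_pos _, fun h hd hne hb h0 => ?_⟩
  obtain ⟨l, hld, hle, hl0⟩ := exists_log hR hd hne
  have := Complex.borelCaratheodory hM0 hld (fun x hx => by
    show (l x).re ≤ M'
    rw [hM', Real.le_log_iff_exp_le (by positivity), ← Complex.norm_exp, hle x hx]
    exact (hb x hx).trans (le_max_left _ _)) hR hz
  rw [hl0, h0] at this
  rw [← hle z hz, Complex.norm_exp]
  refine Real.exp_le_exp.2 ?_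
  have h2 := Complex.abs_re_le_norm (l z)
  have h3 := neg_abs_le (l z).re
  linarith

end Schottky

section Limit

open MeasureTheory

theorem exists_tendsto_of_eventually_norm_le {ι : Type*} {U : Ultrafilter ι} {f : ι → ℂ} {M : ℝ}
    (h : ∀ᶠ i in U, ‖f i‖ ≤ M) : ∃ w, Filter.Tendsto f U (nhds w) := by
  obtain ⟨w, -, hw⟩ := (isCompact_closedBall (0 : ℂ) M).ultrafilter_le_nhds (U.map f)
    (by
      rw [Filter.le_principal_iff]
      have : ∀ᶠ i in U, f i ∈ closedBall (0 : ℂ) M := h.mono fun i hi => by simpa using hi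
      exact this)
  exact ⟨w, hw⟩

theorem norm_sub_sub_deriv_mul_le {f : ℂ → ℂ} {z : ℂ} {δ M : ℝ}
    (hf : DifferentiableOn ℂ f (ball z δ)) (hM : ∀ w ∈ ball z δ, ‖f w‖ ≤ M) (hδ : 0 < δ) :
    ‖deriv f z‖ ≤ 2 * M / δ ∧
      ∀ w ∈ ball z δ, ‖f w - f z - deriv f z * (w - z)‖ ≤ 4 * M * (‖w - z‖ / δ) ^ 2 := by
  have hz : z ∈ ball z δ := mem_ball_self hδ
  have hd : ‖deriv f z‖ ≤ 2 * M / δ :=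
    Complex.norm_deriv_le_div_of_mapsTo_ball hf (fun w hw => by
      rw [mem_closedBall, dist_eq_norm]
      exact (norm_sub_le _ _).trans (by linarith [hM w hw, hM z hz])) hδ
  refine ⟨hd, fun w hw => ?_⟩
  have hM0 : 0 ≤ M := (norm_nonneg _).trans (hM z hz)
  have key := Complex.dist_le_mul_div_pow_of_mapsTo_ball_of_isLittleO (n := 1) (R₂ := 4 * M)
    (f := fun w => f w - deriv f z * (w - z)) (c := z) (z := w) (R₁ := δ)
    (hf.sub (by fun_prop)) (fun x hx => ?_) ?_ hw
  · rw [dist_eq_norm, dist_eq_norm] at key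
    refine le_trans (le_of_eq (congrArg norm ?_)) key
    ring_nf
  · rw [mem_closedBall, dist_eq_norm, sub_self, mul_zero, sub_zero]
    have h1 : ‖deriv f z * (x - z)‖ ≤ 2 * M := by
      rw [norm_mul]
      rw [mem_ball, dist_eq_norm] at hx
      calc ‖deriv f z‖ * ‖x - z‖ ≤ 2 * M / δ * δ := by gcongr
        _ = 2 * M := by field_simp
    calc _ ≤ ‖f x‖ + ‖deriv f z * (x - z)‖ + ‖f z‖ :=
          (norm_sub_le _ _).trans (add_le_add_left (norm_sub_le _ _) _)
      _ ≤ _ := by linarith [hM x hx, hM z hz]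
  · have h1 := (hf.differentiableAt (isOpen_ball.mem_nhds hz)).hasDerivAt
    rw [hasDerivAt_iff_isLittleO] at h1
    refine h1.norm_right.congr (fun x => ?_) fun x => (pow_one _).symm
    simp only [smul_eq_mul]
    ring

/-- Locally bounded ultrafilter limits of holomorphic functions are holomorphic. -/
theorem exists_differentiableOn_limit {ι : Type*} {U : Ultrafilter ι} {f : ι → ℂ → ℂ}
    (h : ∀ s < (1 : ℝ), ∃ M : ℝ, ∀ᶠ i in U, DifferentiableOn ℂ (f i) (ball 0 s) ∧
      ∀ z ∈ ball (0 : ℂ) s, ‖f i z‖ ≤ M) :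
    ∃ F : ℂ → ℂ, DifferentiableOn ℂ F (ball 0 1) ∧
      ∀ z ∈ ball (0 : ℂ) 1, Filter.Tendsto (fun i => f i z) U (nhds (F z)) := by
  have hlim : ∀ z, ∃ w, z ∈ ball (0 : ℂ) 1 → Filter.Tendsto (fun i => f i z) U (nhds w) := by
    intro z
    by_cases hz : z ∈ ball (0 : ℂ) 1
    · rw [mem_ball_zero_iff] at hz
      obtain ⟨s, hzs, hs⟩ := exists_between hz
      obtain ⟨M, hM⟩ := h s hs
      obtain ⟨w, hw⟩ := exists_tendsto_of_eventually_norm_le (f := fun i => f i z)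
        (hM.mono fun i hi => hi.2 z (by simpa using hzs))
      exact ⟨w, fun _ => hw⟩
    · exact ⟨0, fun h => absurd h hz⟩
  choose F hF using hlim
  refine ⟨F, fun z hz => ?_, hF⟩
  have hz1 := mem_ball_zero_iff.1 hz
  obtain ⟨s, hzs, hs⟩ := exists_between hz1
  obtain ⟨M, hM⟩ := h s hs
  set δ := s - ‖z‖ with hδ
  have hδ0 : 0 < δ := by linarith
  have hsub : ball z δ ⊆ ball 0 s := fun x hx => by
    rw [mem_ball, dist_eq_norm] at hx
    rw [mem_ball_zero_iff]
    linarith [norm_le_norm_add_norm_sub' x z]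
  have hest : ∀ᶠ i in U, ‖deriv (f i) z‖ ≤ 2 * M / δ ∧
      ∀ w ∈ ball z δ, ‖f i w - f i z - deriv (f i) z * (w - z)‖ ≤ 4 * M * (‖w - z‖ / δ) ^ 2 :=
    hM.mono fun i hi => norm_sub_sub_deriv_mul_le (hi.1.mono hsub)
      (fun w hw => hi.2 w (hsub hw)) hδ0
  obtain ⟨D, hD⟩ := exists_tendsto_of_eventually_norm_le (hest.mono fun i hi => hi.1)
  have hlim : ∀ w ∈ ball z δ, ‖F w - F z - D * (w - z)‖ ≤ 4 * M * (‖w - z‖ / δ) ^ 2 := by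
    intro w hw
    have hw1 : w ∈ ball (0 : ℂ) 1 := ball_subset_ball hs.le (hsub hw)
    refine le_of_tendsto (((hF w hw1).sub (hF z hz)).sub (hD.mul_const (w - z))).norm ?_
    exact hest.mono fun i hi => hi.2 w hw
  suffices HasDerivAt F D z from this.differentiableAt.differentiableWithinAt
  rw [hasDerivAt_iff_isLittleO]
  have hO : (fun w => F w - F z - (w - z) • D) =O[nhds z] fun w => (w - z) ^ 2 := by
    refine Asymptotics.IsBigO.of_bound (4 * M / δ ^ 2) ?_
    filter_upwards [ball_mem_nhds z hδ0] with w hw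
    rw [smul_eq_mul, mul_comm (w - z) D, norm_pow]
    refine (hlim w hw).trans_eq ?_
    rw [div_pow, mul_div_assoc', div_mul_eq_mul_div]
  refine hO.trans_isLittleO ?_
  have hsq : (fun w : ℂ => w ^ 2) =o[nhds 0] fun w => w := Asymptotics.isLittleO_pow_id one_lt_two
  have ht : Filter.Tendsto (fun w : ℂ => w - z) (nhds z) (nhds 0) := by
    have : Continuous fun w : ℂ => w - z := by fun_prop
    simpa using this.tendsto z
  exact hsq.comp_tendsto ht

/-- Extension of a normalised holomorphic motion of a subset of the plane. -/
theorem exists_extension_of_normalized {B : Set ℂ} (hB0 : (0 : ℂ) ∈ B) (hB1 : (1 : ℂ) ∈ B)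
    (φ : ℂ → ℂ → ℂ) (hd : ∀ z ∈ B, DifferentiableOn ℂ (fun c => φ c z) (ball 0 1))
    (hinj : ∀ c ∈ ball (0 : ℂ) 1, InjOn (φ c) B) (hid : ∀ z ∈ B, φ 0 z = z)
    (h0 : ∀ c ∈ ball (0 : ℂ) 1, φ c 0 = 0) (h1 : ∀ c ∈ ball (0 : ℂ) 1, φ c 1 = 1) :
    ∃ Φ : ℂ → ℂ → ℂ, (∀ a, DifferentiableOn ℂ (fun c => Φ c a) (ball 0 1)) ∧
      (∀ c ∈ ball (0 : ℂ) 1, Function.Injective (Φ c)) ∧ (∀ a, Φ 0 a = a) ∧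
      ∀ c ∈ ball (0 : ℂ) 1, ∀ z ∈ B, Φ c z = φ c z := by
  classical
  set rad : ℕ → ℝ := fun n => 1 - 1 / ((n : ℝ) + 2) with hrad
  have hrad0 : ∀ n, 0 < rad n := fun n => by
    have hn : (0 : ℝ) ≤ n := n.cast_nonneg
    simp only [hrad, sub_pos]
    rw [div_lt_one (by positivity)]
    linarith
  have hrad1 : ∀ n, rad n < 1 := fun n => by
    simp only [hrad]
    have : (0 : ℝ) < 1 / ((n : ℝ) + 2) := by positivity
    linarith
  set S : Finset B × ℕ → Finset ℂ := fun i => insert 0 (insert 1 (i.1.image Subtype.val)) with hS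
  have hSB : ∀ i, ∀ z ∈ S i, z ∈ B := by
    intro i z hz
    simp only [hS, Finset.mem_insert, Finset.mem_image] at hz
    rcases hz with rfl | rfl | ⟨x, -, rfl⟩
    · exact hB0
    · exact hB1
    · exact x.2
  have hex := fun i : Finset B × ℕ => exists_extension_of_finite (S i) φ
    (fun z hz => hd z (hSB i z hz)) (fun c hc => (hinj c hc).mono (hSB i))
    (fun z hz => hid z (hSB i z hz)) (hrad0 i.2) (hrad1 i.2)
  choose Ψ hΨd hΨinj hΨid hΨS using hex
  set U : Ultrafilter (Finset B × ℕ) := Ultrafilter.of Filter.atTop with hU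
  have hUle : (U : Filter (Finset B × ℕ)) ≤ Filter.atTop := Ultrafilter.of_le _
  have hrU : ∀ s < (1 : ℝ), ∀ᶠ i : Finset B × ℕ in U, s ≤ rad i.2 := by
    intro s hs
    obtain ⟨N, hN⟩ := exists_nat_gt (1 / (1 - s))
    refine hUle (Filter.mem_of_superset (Filter.mem_atTop (∅, N)) fun i hi => ?_)
    have hNi : (N : ℝ) ≤ i.2 := by exact_mod_cast hi.2
    show s ≤ 1 - 1 / ((i.2 : ℝ) + 2)
    have hs' : 0 < 1 - s := by linarith
    have h2 : 1 / ((i.2 : ℝ) + 2) ≤ 1 - s := by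
      rw [div_le_comm₀ (by positivity) hs']
      linarith
    linarith
  have hSU : ∀ z ∈ B, ∀ᶠ i in U, z ∈ S i := by
    intro z hz
    refine hUle (Filter.mem_of_superset (Filter.mem_atTop ({⟨z, hz⟩}, 0)) fun i hi => ?_)
    have : (⟨z, hz⟩ : B) ∈ i.1 := hi.1 (Finset.mem_singleton_self _)
    show z ∈ S i
    simp only [hS, Finset.mem_insert, Finset.mem_image]
    exact Or.inr (Or.inr ⟨_, this, rfl⟩)
  have hbound : ∀ a : ℂ, ∀ s < (1 : ℝ), ∃ M : ℝ, ∀ᶠ i in U,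
      DifferentiableOn ℂ (fun c => Ψ i c a) (ball 0 s) ∧ ∀ c ∈ ball (0 : ℂ) s, ‖Ψ i c a‖ ≤ M := by
    intro a s hs
    have hsm : max s 0 < 1 := max_lt hs one_pos
    obtain ⟨R, hR1, hR2⟩ := exists_between hsm
    have hv0 : ∀ i, R ≤ rad i.2 → ∀ c ∈ ball (0 : ℂ) R, Ψ i c 0 = 0 := by
      intro i hi c hc
      rw [hΨS i c (ball_subset_ball hi hc) 0 (by simp [hS]),
        h0 c (ball_subset_ball hR2.le hc)]
    have hv1 : ∀ i, R ≤ rad i.2 → ∀ c ∈ ball (0 : ℂ) R, Ψ i c 1 = 1 := by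
      intro i hi c hc
      rw [hΨS i c (ball_subset_ball hi hc) 1 (by simp [hS]),
        h1 c (ball_subset_ball hR2.le hc)]
    have hsR : ball (0 : ℂ) s ⊆ ball 0 R := ball_subset_ball ((le_max_left _ _).trans hR1.le)
    obtain ⟨M, hM⟩ := exists_schottky_bound (le_max_right s 0) hR1 a
    refine ⟨max M 1, ?_⟩
    filter_upwards [hrU R hR2] with i hi
    have hdi : DifferentiableOn ℂ (fun c => Ψ i c a) (ball 0 R) :=
      (hΨd i a).mono (ball_subset_ball hi)
    refine ⟨hdi.mono hsR, fun c hc => ?_⟩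
    by_cases ha0 : a = 0
    · rw [ha0, hv0 i hi c (hsR hc)]; simp
    by_cases ha1 : a = 1
    · rw [ha1, hv1 i hi c (hsR hc)]; simp
    refine (hM _ hdi (fun x hx => ⟨fun h => ha0 ?_, fun h => ha1 ?_⟩) (hΨid i a) c
      (ball_subset_closedBall (ball_subset_ball (le_max_left _ _) hc))).trans (le_max_left _ _)
    · exact hΨinj i x (h.trans (hv0 i hi x hx).symm)
    · exact hΨinj i x (h.trans (hv1 i hi x hx).symm)
  choose Φ hΦd hΦ using fun a => exists_differentiableOn_limit (hbound a)
  refine ⟨fun c a => Φ a c, hΦd, fun c hc a b hab => ?_, fun a => ?_, fun c hc z hz => ?_⟩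
  · by_contra hne
    have hc1 := mem_ball_zero_iff.1 hc
    obtain ⟨s, hcs, hs⟩ := exists_between hc1
    obtain ⟨M₁, hM₁⟩ := hbound a s hs
    obtain ⟨M₂, hM₂⟩ := hbound b s hs
    obtain ⟨m, hm, hlow⟩ := exists_lower_bound_of_ne_zero (M₁ + M₂) (c := a - b)
      (z := c) (R := s) (by simpa using hcs)
    have : m ≤ ‖Φ a c - Φ b c‖ := by
      refine ge_of_tendsto ((hΦ a c hc).sub (hΦ b c hc)).norm ?_
      filter_upwards [hM₁, hM₂] with i hi₁ hi₂
      refine hlow (fun c => Ψ i c a - Ψ i c b) (hi₁.1.sub hi₂.1)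
        (fun x _ h => hne (hΨinj i x (sub_eq_zero.1 h)))
        (fun x hx => (norm_sub_le _ _).trans (add_le_add (hi₁.2 x hx) (hi₂.2 x hx))) ?_
      simp only [hΨid]
    simp only [hab, sub_self, norm_zero] at this
    linarith
  · have := hΦ a 0 (mem_ball_self one_pos)
    simp only [hΨid] at this
    exact tendsto_nhds_unique this tendsto_const_nhds
  · have hc1 := mem_ball_zero_iff.1 hc
    obtain ⟨s, hcs, hs⟩ := exists_between hc1
    refine tendsto_nhds_unique (hΦ z c hc) (Filter.Tendsto.congr' ?_ tendsto_const_nhds)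
    filter_upwards [hSU z hz, hrU s hs] with i hi hr
    exact (hΨS i c (ball_subset_ball hr (by simpa using hcs)) z hi).symm

end Limit

section Sphere

open Filter Topology

/-- The point of the Riemann sphere with homogeneous coordinates `[p : q]`. -/
def toSphere (p q : ℂ) : OnePoint ℂ :=
  if q = 0 then OnePoint.infty else ((p / q : ℂ) : OnePoint ℂ)

@[simp] theorem toSphere_one_right (p : ℂ) : toSphere p 1 = (p : OnePoint ℂ) := by
  simp [toSphere]

@[simp] theorem toSphere_zero_right (p : ℂ) : toSphere p 0 = OnePoint.infty := by
  simp [toSphere]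

theorem toSphere_of_ne {p q : ℂ} (hq : q ≠ 0) : toSphere p q = ((p / q : ℂ) : OnePoint ℂ) := by
  simp [toSphere, hq]

theorem toSphere_eq_infty_iff {p q : ℂ} : toSphere p q = OnePoint.infty ↔ q = 0 := by
  by_cases hq : q = 0 <;> simp [toSphere, hq]

theorem toSphere_mul_left {c : ℂ} (hc : c ≠ 0) (p q : ℂ) :
    toSphere (c * p) (c * q) = toSphere p q := by
  by_cases hq : q = 0
  · simp [hq]
  · rw [toSphere_of_ne hq, toSphere_of_ne (mul_ne_zero hc hq), mul_div_mul_left _ _ hc]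

@[simp] theorem sphereInv_infty : sphereInv OnePoint.infty = ((0 : ℂ) : OnePoint ℂ) := rfl

theorem sphereInv_coe (z : ℂ) :
    sphereInv (z : OnePoint ℂ) = if z = 0 then OnePoint.infty else ((z⁻¹ : ℂ) : OnePoint ℂ) := rfl

@[simp] theorem sphereInv_sphereInv (x : OnePoint ℂ) : sphereInv (sphereInv x) = x := by
  induction x using OnePoint.rec with
  | infty => simp [sphereInv_coe]
  | coe z => by_cases hz : z = 0 <;> simp [sphereInv_coe, hz]

theorem sphereInv_toSphere {p q : ℂ} (h : p ≠ 0 ∨ q ≠ 0) :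
    sphereInv (toSphere p q) = toSphere q p := by
  by_cases hq : q = 0
  · have hp : p ≠ 0 := by simpa [hq] using h
    simp [hq, toSphere, hp]
  · by_cases hp : p = 0 <;> simp [hq, hp, toSphere, sphereInv_coe]

theorem holomorphicOnSphere_iff {u : ℂ → OnePoint ℂ} {s : Set ℂ} :
    HolomorphicOnSphere u s ↔ ∀ z ∈ s, ∃ p q : ℂ → ℂ, AnalyticAt ℂ p z ∧ AnalyticAt ℂ q z ∧
      (p z ≠ 0 ∨ q z ≠ 0) ∧ ∀ᶠ w in 𝓝 z, u w = toSphere (p w) (q w) := by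
  refine forall₂_congr fun z _ => ⟨?_, ?_⟩
  · rintro ⟨v, hv, h | h⟩
    · exact ⟨v, fun _ => 1, hv, analyticAt_const, Or.inr one_ne_zero, by simpa using h⟩
    · refine ⟨fun _ => 1, v, analyticAt_const, hv, Or.inl one_ne_zero, ?_⟩
      filter_upwards [h] with w hw
      rw [← sphereInv_sphereInv (u w), hw, ← toSphere_one_right, sphereInv_toSphere (by simp)]
  · rintro ⟨p, q, hp, hq, h0, h⟩
    by_cases hqz : q z = 0
    · have hpz : p z ≠ 0 := by simpa [hqz] using h0
      refine ⟨fun w => q w / p w, hq.div hp hpz, Or.inr ?_⟩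
      filter_upwards [h, hp.continuousAt.eventually_ne hpz] with w hw hpw
      rw [hw, sphereInv_toSphere (Or.inl hpw), toSphere_of_ne hpw]
    · refine ⟨fun w => p w / q w, hp.div hq hqz, Or.inl ?_⟩
      filter_upwards [h, hq.continuousAt.eventually_ne hqz] with w hw hqw
      rw [hw, toSphere_of_ne hqw]

theorem smul_toSphere (G : GL (Fin 2) ℂ) {p q : ℂ} (h : p ≠ 0 ∨ q ≠ 0) :
    G • toSphere p q = toSphere (G 0 0 * p + G 0 1 * q) (G 1 0 * p + G 1 1 * q) := by
  by_cases hq : q = 0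
  · have hp : p ≠ 0 := by simpa [hq] using h
    rw [hq, toSphere_zero_right, OnePoint.smul_infty_eq_ite]
    simp only [mul_zero, add_zero, mul_comm _ p]
    rw [toSphere_mul_left hp]
    rfl
  · rw [toSphere_of_ne hq, OnePoint.smul_some_eq_ite]
    have h2 : toSphere (G 0 0 * p + G 0 1 * q) (G 1 0 * p + G 1 1 * q) =
        toSphere (q * (G 0 0 * (p / q) + G 0 1)) (q * (G 1 0 * (p / q) + G 1 1)) := by
      congr 1 <;> field_simp
    rw [h2, toSphere_mul_left hq]
    rfl

/-- A holomorphic family of invertible matrices over the unit disk. -/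
def HolomorphicFamily (G : ℂ → GL (Fin 2) ℂ) : Prop :=
  ∀ i j, DifferentiableOn ℂ (fun l => G l i j) (ball 0 1)

theorem HolomorphicFamily.inv {G : ℂ → GL (Fin 2) ℂ} (hG : HolomorphicFamily G) :
    HolomorphicFamily fun l => (G l)⁻¹ := by
  have hdet : DifferentiableOn ℂ (fun l => (G l 0 0 * G l 1 1 - G l 0 1 * G l 1 0)⁻¹)
      (ball 0 1) := by
    refine (((hG 0 0).mul (hG 1 1)).sub ((hG 0 1).mul (hG 1 0))).inv fun l _ => ?_
    have := (G l).det_ne_zero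
    rwa [Matrix.det_fin_two] at this
  have key : ∀ l, ((G l)⁻¹ : GL (Fin 2) ℂ).1 =
      (G l 0 0 * G l 1 1 - G l 0 1 * G l 1 0)⁻¹ • !![G l 1 1, -G l 0 1; -G l 1 0, G l 0 0] := by
    intro l
    rw [Matrix.coe_units_inv, Matrix.inv_def, Matrix.adjugate_fin_two, Matrix.det_fin_two,
      Ring.inverse_eq_inv']
  intro i j
  simp only [key, Matrix.smul_apply, smul_eq_mul]
  refine hdet.mul ?_
  fin_cases i <;> fin_cases j
  · exact hG 1 1
  · exact (hG 0 1).neg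
  · exact (hG 1 0).neg
  · exact hG 0 0

theorem HolomorphicFamily.smul {G : ℂ → GL (Fin 2) ℂ} (hG : HolomorphicFamily G)
    {u : ℂ → OnePoint ℂ} (hu : HolomorphicOnSphere u (ball 0 1)) :
    HolomorphicOnSphere (fun l => G l • u l) (ball 0 1) := by
  rw [holomorphicOnSphere_iff] at hu ⊢
  intro z hz
  obtain ⟨p, q, hp, hq, h0, h⟩ := hu z hz
  have hGa : ∀ i j, AnalyticAt ℂ (fun l => G l i j) z := fun i j =>
    (hG i j).analyticAt (isOpen_ball.mem_nhds hz)
  refine ⟨fun w => G w 0 0 * p w + G w 0 1 * q w, fun w => G w 1 0 * p w + G w 1 1 * q w,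
    ((hGa 0 0).mul hp).add ((hGa 0 1).mul hq), ((hGa 1 0).mul hp).add ((hGa 1 1).mul hq), ?_, ?_⟩
  · by_contra! hc
    have hd := (G z).det_ne_zero
    rw [Matrix.det_fin_two] at hd
    have e1 : (G z 0 0 * G z 1 1 - G z 0 1 * G z 1 0) * p z = 0 := by
      linear_combination (G z 1 1) * hc.1 - (G z 0 1) * hc.2
    have e2 : (G z 0 0 * G z 1 1 - G z 0 1 * G z 1 0) * q z = 0 := by
      linear_combination (G z 0 0) * hc.2 - (G z 1 0) * hc.1
    rcases h0 with h0 | h0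
    · exact (mul_ne_zero hd h0) e1
    · exact (mul_ne_zero hd h0) e2
  · have hne : ∀ᶠ w in 𝓝 z, p w ≠ 0 ∨ q w ≠ 0 := by
      rcases h0 with h0 | h0
      · exact (hp.continuousAt.eventually_ne h0).mono fun _ => Or.inl
      · exact (hq.continuousAt.eventually_ne h0).mono fun _ => Or.inr
    filter_upwards [h, hne] with w hw hw'
    rw [hw, smul_toSphere _ hw']

/-- The motion obtained from `f` by a change of coordinates depending on the parameter. -/
theorem isHolomorphicMotion_conj {A : Set (OnePoint ℂ)} {f : ℂ → OnePoint ℂ → OnePoint ℂ}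
    (hf : IsHolomorphicMotion A f) {G : ℂ → GL (Fin 2) ℂ} (hG : HolomorphicFamily G) :
    IsHolomorphicMotion {a | G 0 • a ∈ A} fun l a => (G l)⁻¹ • f l (G 0 • a) := by
  refine ⟨fun a ha => hG.inv.smul (hf.1 _ ha), fun l hl a ha b hb hab => ?_, fun a ha => ?_⟩
  · exact smul_left_cancel _ (hf.2.1 l hl ha hb (smul_left_cancel _ hab))
  · simp only [hf.2.2 _ ha, inv_smul_smul]

/-- A motion extends to the whole sphere. -/
def Extends (A : Set (OnePoint ℂ)) (f : ℂ → OnePoint ℂ → OnePoint ℂ) : Prop :=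
  ∃ F : ℂ → OnePoint ℂ → OnePoint ℂ, IsHolomorphicMotion Set.univ F ∧
    ∀ l ∈ ball (0 : ℂ) 1, ∀ a ∈ A, F l a = f l a

theorem Extends.of_conj {A : Set (OnePoint ℂ)} {f : ℂ → OnePoint ℂ → OnePoint ℂ}
    {G : ℂ → GL (Fin 2) ℂ} (hG : HolomorphicFamily G)
    (h : Extends {a | G 0 • a ∈ A} fun l a => (G l)⁻¹ • f l (G 0 • a)) : Extends A f := by
  obtain ⟨F, hF, hext⟩ := h
  have h2 := isHolomorphicMotion_conj hF hG.inv
  refine ⟨fun l a => G l • F l ((G 0)⁻¹ • a), ?_, fun l hl a ha => ?_⟩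
  · simpa using h2
  · simp only
    rw [hext l hl _ (by simpa using ha)]
    simp

theorem holomorphicOnSphere_const (a : OnePoint ℂ) (s : Set ℂ) :
    HolomorphicOnSphere (fun _ => a) s := by
  intro z _
  induction a using OnePoint.rec with
  | infty => exact ⟨fun _ => 0, analyticAt_const, Or.inr (by simp)⟩
  | coe a => exact ⟨fun _ => a, analyticAt_const, Or.inl (by simp)⟩

theorem holomorphicOnSphere_congr {u v : ℂ → OnePoint ℂ} {s : Set ℂ} (hs : IsOpen s)
    (hu : HolomorphicOnSphere u s) (h : ∀ z ∈ s, v z = u z) : HolomorphicOnSphere v s := by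
  rw [holomorphicOnSphere_iff] at hu ⊢
  intro z hz
  obtain ⟨p, q, hp, hq, h0, hpq⟩ := hu z hz
  refine ⟨p, q, hp, hq, h0, ?_⟩
  filter_upwards [hpq, hs.mem_nhds hz] with w hw hws
  rw [h w hws, hw]

theorem holomorphicOnSphere_coe {φ : ℂ → ℂ} {s : Set ℂ} (hs : IsOpen s) :
    HolomorphicOnSphere (fun z => (φ z : OnePoint ℂ)) s ↔ DifferentiableOn ℂ φ s := by
  refine ⟨fun h z hz => ?_, fun h z hz => ⟨φ, h.analyticAt (hs.mem_nhds hz), Or.inl (by simp)⟩⟩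
  obtain ⟨p, q, hp, hq, h0, hpq⟩ := holomorphicOnSphere_iff.1 h z hz
  have hqz : q z ≠ 0 := fun hc => by
    have := hpq.self_of_nhds
    simp [hc] at this
  have : φ =ᶠ[𝓝 z] fun w => p w / q w := by
    filter_upwards [hpq, hq.continuousAt.eventually_ne hqz] with w hw hqw
    rw [toSphere_of_ne hqw] at hw
    exact OnePoint.coe_injective hw
  exact ((hp.div hq hqz).congr this.symm).differentiableAt.differentiableWithinAt

theorem extends_of_fixed {A : Set (OnePoint ℂ)} {f : ℂ → OnePoint ℂ → OnePoint ℂ}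
    (h : ∀ l ∈ ball (0 : ℂ) 1, ∀ a ∈ A, f l a = a) : Extends A f :=
  ⟨fun _ a => a, ⟨fun a _ => holomorphicOnSphere_const a _, fun _ _ => injOn_id _, fun _ _ => rfl⟩,
    fun l hl a ha => (h l hl a ha).symm⟩

/-- The finite coordinate of a point of the sphere, with value `0` at infinity. -/
def finitePart (x : OnePoint ℂ) : ℂ := Option.elim x 0 id

@[simp] theorem finitePart_coe (z : ℂ) : finitePart (z : OnePoint ℂ) = z := rfl

theorem coe_finitePart {x : OnePoint ℂ} (hx : x ≠ OnePoint.infty) :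
    ((finitePart x : ℂ) : OnePoint ℂ) = x := by
  induction x using OnePoint.rec with
  | infty => exact absurd rfl hx
  | coe z => rfl

theorem differentiableOn_finitePart {u : ℂ → OnePoint ℂ} {s : Set ℂ} (hs : IsOpen s)
    (hu : HolomorphicOnSphere u s) (h : ∀ z ∈ s, u z ≠ OnePoint.infty) :
    DifferentiableOn ℂ (fun z => finitePart (u z)) s :=
  (holomorphicOnSphere_coe hs).1 (holomorphicOnSphere_congr hs hu fun z hz => coe_finitePart (h z hz))

theorem extends_of_fixed_three {A : Set (OnePoint ℂ)} {f : ℂ → OnePoint ℂ → OnePoint ℂ}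
    (hf : IsHolomorphicMotion A f) (hi : OnePoint.infty ∈ A) (h0 : ((0 : ℂ) : OnePoint ℂ) ∈ A)
    (h1 : ((1 : ℂ) : OnePoint ℂ) ∈ A)
    (hfi : ∀ l ∈ ball (0 : ℂ) 1, f l OnePoint.infty = OnePoint.infty)
    (hf0 : ∀ l ∈ ball (0 : ℂ) 1, f l ((0 : ℂ) : OnePoint ℂ) = ((0 : ℂ) : OnePoint ℂ))
    (hf1 : ∀ l ∈ ball (0 : ℂ) 1, f l ((1 : ℂ) : OnePoint ℂ) = ((1 : ℂ) : OnePoint ℂ)) :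
    Extends A f := by
  have hfin : ∀ l ∈ ball (0 : ℂ) 1, ∀ z : ℂ, (z : OnePoint ℂ) ∈ A →
      f l (z : OnePoint ℂ) ≠ OnePoint.infty := by
    intro l hl z hz h
    exact OnePoint.coe_ne_infty z (hf.2.1 l hl hz hi (h.trans (hfi l hl).symm))
  obtain ⟨Φ, hΦd, hΦi, hΦ0, hΦ⟩ := exists_extension_of_normalized
    (B := {z : ℂ | (z : OnePoint ℂ) ∈ A}) h0 h1 (fun l z => finitePart (f l z))
    (fun z hz => differentiableOn_finitePart isOpen_ball (hf.1 _ hz) fun l hl => hfin l hl z hz)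
    (fun l hl z hz w hw hzw => by
      have := congrArg (fun x : ℂ => (x : OnePoint ℂ)) hzw
      simp only [coe_finitePart (hfin l hl z hz), coe_finitePart (hfin l hl w hw)] at this
      exact OnePoint.coe_injective (hf.2.1 l hl hz hw this))
    (fun z hz => by simp only [hf.2.2 _ hz, finitePart_coe])
    (fun l hl => by simp only [hf0 l hl, finitePart_coe])
    (fun l hl => by simp only [hf1 l hl, finitePart_coe])
  refine ⟨fun l a => OnePoint.map (Φ l) a, ⟨fun a _ => ?_, fun l hl => ?_, fun a _ => ?_⟩,
    fun l hl a ha => ?_⟩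
  · induction a using OnePoint.rec with
    | infty => exact holomorphicOnSphere_const _ _
    | coe z => exact (holomorphicOnSphere_coe isOpen_ball).2 (hΦd z)
  · exact (Option.map_injective (hΦi l hl)).injOn
  · induction a using OnePoint.rec with
    | infty => rfl
    | coe z => exact congrArg _ (hΦ0 z)
  · induction a using OnePoint.rec with
    | infty => exact (hfi l hl).symm
    | coe z =>
      simp only [OnePoint.map_some]
      rw [ hΦ l hl z ha, coe_finitePart (hfin l hl z ha)]

end Sphere

section Cousin

open Filter Topology

/-- The radii `1 - 1 / (n + 2)` of an exhaustion of the unit disk. -/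
def rad (n : ℕ) : ℝ := 1 - 1 / (n + 2)

theorem rad_pos (n : ℕ) : 0 < rad n := by
  have : (1 : ℝ) / (n + 2) < 1 := by rw [div_lt_one (by positivity)]; linarith [n.cast_nonneg (α := ℝ)]
  simp only [rad]; linarith

theorem rad_lt_one (n : ℕ) : rad n < 1 := by
  have : (0 : ℝ) < 1 / (n + 2) := by positivity
  simp only [rad]; linarith

theorem strictMono_rad : StrictMono rad := by
  refine strictMono_nat_of_lt_succ fun n => ?_
  have : (1 : ℝ) / ((n + 1 : ℕ) + 2) < 1 / (n + 2) := by
    apply one_div_lt_one_div_of_lt (by positivity)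
    push_cast; linarith
  simp only [rad]; linarith

theorem ball_rad_subset {m n : ℕ} (h : m ≤ n) : ball (0 : ℂ) (rad m) ⊆ ball 0 (rad n) :=
  ball_subset_ball (strictMono_rad.monotone h)

theorem ball_rad_subset_unit (n : ℕ) : ball (0 : ℂ) (rad n) ⊆ ball 0 1 :=
  ball_subset_ball (rad_lt_one n).le

theorem exists_mem_ball_rad {z : ℂ} (hz : z ∈ ball (0 : ℂ) 1) : ∃ n, z ∈ ball (0 : ℂ) (rad n) := by
  rw [mem_ball_zero_iff] at hz
  obtain ⟨n, hn⟩ := exists_nat_gt (1 / (1 - ‖z‖))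
  refine ⟨n, ?_⟩
  rw [mem_ball_zero_iff, rad]
  have h1 : 0 < 1 - ‖z‖ := by linarith
  have : 1 / ((n : ℝ) + 2) < 1 - ‖z‖ := by
    rw [div_lt_iff₀ h1] at hn
    rw [div_lt_iff₀ (by positivity)]
    nlinarith
  linarith

theorem exists_entire_approx {w : ℂ → ℂ} {r R ε : ℝ} (hr : 0 < r) (hrR : r < R) (hε : 0 < ε)
    (hw : DifferentiableOn ℂ w (ball 0 R)) :
    ∃ π : ℂ → ℂ, Differentiable ℂ π ∧ ∀ z ∈ ball (0 : ℂ) r, ‖w z - π z‖ ≤ ε := by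
  lift r to NNReal using hr.le
  have hρ : 0 < (r + R) / 2 := by linarith
  obtain ⟨ρ, hρ'⟩ : ∃ ρ : NNReal, (ρ : ℝ) = (r + R) / 2 := ⟨⟨_, hρ.le⟩, rfl⟩
  have hp := DifferentiableOn.hasFPowerSeriesOnBall (R := ρ) (c := (0 : ℂ)) (f := w)
    (hw.mono (closedBall_subset_ball (by rw [hρ']; linarith)))
    (by rw [← NNReal.coe_pos, hρ']; exact hρ)
  have hu := hp.tendstoUniformlyOn' (r' := r)
    (by rw [ENNReal.coe_lt_coe, ← NNReal.coe_lt_coe, hρ']; linarith)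
  obtain ⟨n, hn⟩ := (Metric.tendstoUniformlyOn_iff.1 hu ε hε).exists
  refine ⟨fun z => (cauchyPowerSeries w 0 ρ).partialSum n (z - 0), ?_, fun z hz => ?_⟩
  · simp only [sub_zero, FormalMultilinearSeries.partialSum,
      FormalMultilinearSeries.apply_eq_prod_smul_coeff, Finset.prod_const, smul_eq_mul]
    fun_prop
  · rw [← dist_eq_norm]; exact (hn z hz).le

theorem exists_cousin {w : ℕ → ℂ → ℂ} (hw : ∀ n, DifferentiableOn ℂ (w n) (ball 0 (rad n))) :
    ∃ v : ℕ → ℂ → ℂ, (∀ n, DifferentiableOn ℂ (v n) (ball 0 (rad n))) ∧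
      ∀ n, ∀ z ∈ ball (0 : ℂ) (rad n), w n z = v (n + 1) z - v n z := by
  have happ : ∀ n, ∃ π : ℂ → ℂ, Differentiable ℂ π ∧
      ∀ z ∈ ball (0 : ℂ) (rad n), ‖w (n + 1) z - π z‖ ≤ (1 / 2 : ℝ) ^ n := fun n =>
    exists_entire_approx (rad_pos n) (strictMono_rad n.lt_succ_self) (by positivity) (hw (n + 1))
  choose π hπd hπ using happ
  have hsub : ∀ n j, ∀ z ∈ ball (0 : ℂ) (rad n), z ∈ ball (0 : ℂ) (rad (n + j)) := fun n j z hz =>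
    ball_rad_subset (Nat.le_add_right n j) hz
  have hbound : ∀ n j, ∀ z ∈ ball (0 : ℂ) (rad n),
      ‖w (n + j + 1) z - π (n + j) z‖ ≤ (1 / 2 : ℝ) ^ j := fun n j z hz =>
    (hπ (n + j) z (hsub n j z hz)).trans
      (pow_le_pow_of_le_one (by norm_num) (by norm_num) (Nat.le_add_left j n))
  have hgeom : Summable fun j : ℕ => (1 / 2 : ℝ) ^ j := summable_geometric_two
  refine ⟨fun n z => -w n z - ∑' j, (w (n + j + 1) z - π (n + j) z) + ∑ k ∈ Finset.range n, π k z,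
    fun n => ?_, fun n z hz => ?_⟩
  · have h1 : DifferentiableOn ℂ (fun z => ∑' j, (w (n + j + 1) z - π (n + j) z))
        (ball 0 (rad n)) :=
      Complex.differentiableOn_tsum_of_summable_norm hgeom
        (fun j => ((hw (n + j + 1)).mono (ball_rad_subset (by omega))).sub
          (hπd (n + j)).differentiableOn) isOpen_ball (hbound n)
    exact ((hw n).neg.sub h1).add
      (DifferentiableOn.fun_sum fun k _ => (hπd k).differentiableOn)
  · have hs : Summable fun j => w (n + j + 1) z - π (n + j) z :=
      Summable.of_norm_bounded hgeom fun j => hbound n j z hz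
    have := hs.tsum_eq_zero_add
    simp only [Finset.sum_range_succ]
    rw [this]
    have h3 : ∀ j, n + 1 + j = n + (j + 1) := fun j => by omega
    simp only [h3, add_zero]
    ring

theorem exists_glue {h : ℕ → ℂ → ℂ} (hd : ∀ n, DifferentiableOn ℂ (h n) (ball 0 (rad n)))
    (hs : ∀ n, ∀ z ∈ ball (0 : ℂ) (rad n), h (n + 1) z = h n z) :
    ∃ H : ℂ → ℂ, DifferentiableOn ℂ H (ball 0 1) ∧
      ∀ n, ∀ z ∈ ball (0 : ℂ) (rad n), H z = h n z := by
  classical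
  have hle : ∀ m n, m ≤ n → ∀ z ∈ ball (0 : ℂ) (rad m), h n z = h m z := by
    intro m n hmn z hz
    induction n, hmn using Nat.le_induction with
    | base => rfl
    | succ n hmn ih => rw [hs n z (ball_rad_subset hmn hz), ih]
  set H : ℂ → ℂ := fun z => if hz : ∃ n, z ∈ ball (0 : ℂ) (rad n) then h hz.choose z else 0
    with hH
  have hHn : ∀ n, ∀ z ∈ ball (0 : ℂ) (rad n), H z = h n z := by
    intro n z hz
    have hex : ∃ n, z ∈ ball (0 : ℂ) (rad n) := ⟨n, hz⟩
    simp only [hH, dif_pos hex]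
    rcases le_total n hex.choose with hc | hc
    · exact hle _ _ hc z hz
    · exact (hle _ _ hc z hex.choose_spec).symm
  refine ⟨H, fun z hz => ?_, hHn⟩
  obtain ⟨n, hn⟩ := exists_mem_ball_rad hz
  have hn' := isOpen_ball.mem_nhds hn
  refine (((hd n).differentiableAt hn').congr_of_eventuallyEq ?_).differentiableWithinAt
  filter_upwards [hn'] with y hy using hHn n y hy

theorem toSphere_eq_cross {p q p' q' : ℂ}
    (he : toSphere p q = toSphere p' q') : p * q' = p' * q := by
  by_cases hq : q = 0
  · have : q' = 0 := by rw [← toSphere_eq_infty_iff (p := p'), ← he, hq, toSphere_zero_right]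
    simp [hq, this]
  · have hq' : q' ≠ 0 := by
      rwa [Ne, ← toSphere_eq_infty_iff (p := p'), ← he, toSphere_eq_infty_iff]
    rw [toSphere_of_ne hq, toSphere_of_ne hq'] at he
    exact (div_eq_div_iff hq hq').1 (OnePoint.coe_injective he)

/-- A lift of a map to the sphere on the disk of radius `r` to a holomorphic family of matrices
`[[p, s], [q, t]]` of determinant `1`. -/
def HasUnimodularLift (f : ℂ → OnePoint ℂ) (r : ℝ) : Prop :=
  ∃ p q s t : ℂ → ℂ, DifferentiableOn ℂ p (ball 0 r) ∧ DifferentiableOn ℂ q (ball 0 r) ∧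
    DifferentiableOn ℂ s (ball 0 r) ∧ DifferentiableOn ℂ t (ball 0 r) ∧
    ∀ z ∈ ball (0 : ℂ) r, p z * t z - q z * s z = 1 ∧ f z = toSphere (p z) (q z)

theorem HasUnimodularLift.unit {f : ℂ → OnePoint ℂ} (h : ∀ n, HasUnimodularLift f (rad n)) :
    HasUnimodularLift f 1 := by
  choose p q s t hp hq hs ht h using h
  have hsub : ∀ n, ∀ z ∈ ball (0 : ℂ) (rad n), z ∈ ball (0 : ℂ) (rad (n + 1)) := fun n z hz =>
    ball_rad_subset n.le_succ hz
  have hne : ∀ n, ∀ z ∈ ball (0 : ℂ) (rad n), p n z ≠ 0 ∨ q n z ≠ 0 := by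
    intro n z hz
    by_contra! hc
    have := (h n z hz).1
    simp [hc.1, hc.2] at this
  set u : ℕ → ℂ → ℂ := fun n z => t n z * p (n + 1) z - s n z * q (n + 1) z with hu
  have hpu : ∀ n, ∀ z ∈ ball (0 : ℂ) (rad n), p (n + 1) z = u n z * p n z ∧
      q (n + 1) z = u n z * q n z := by
    intro n z hz
    have hc := toSphere_eq_cross ((h n z hz).2.symm.trans (h (n + 1) z (hsub n z hz)).2)
    have h1 := (h n z hz).1
    simp only [hu]
    constructor
    · linear_combination s n z * hc - p (n + 1) z * h1
    · linear_combination t n z * hc - q (n + 1) z * h1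
  have hu0 : ∀ n, ∀ z ∈ ball (0 : ℂ) (rad n), u n z ≠ 0 := by
    intro n z hz h0
    have h1 := hpu n z hz
    rw [h0, zero_mul, zero_mul] at h1
    exact (hne (n + 1) z (hsub n z hz)).elim (fun a => a h1.1) (fun a => a h1.2)
  have hd : ∀ {k : ℕ → ℂ → ℂ}, (∀ n, DifferentiableOn ℂ (k n) (ball 0 (rad n))) →
      ∀ n, DifferentiableOn ℂ (k (n + 1)) (ball 0 (rad n)) := fun hk n =>
    (hk (n + 1)).mono (ball_rad_subset n.le_succ)
  have hud : ∀ n, DifferentiableOn ℂ (u n) (ball 0 (rad n)) := fun n =>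
    ((ht n).mul (hd hp n)).sub ((hs n).mul (hd hq n))
  choose w hwd hw _ using fun n => exists_log (rad_pos n) (hud n) (hu0 n)
  obtain ⟨v, hvd, hv⟩ := exists_cousin hwd
  have hexp : ∀ n, ∀ z ∈ ball (0 : ℂ) (rad n), exp (v (n + 1) z) = exp (v n z) * u n z := by
    intro n z hz
    rw [← hw n z hz, hv n z hz, ← Complex.exp_add]
    ring_nf
  obtain ⟨P, hPd, hP⟩ := exists_glue (h := fun n z => exp (-v n z) * p n z)
    (fun n => (hvd n).neg.cexp.mul (hp n)) fun n z hz => by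
      simp only [Complex.exp_neg, hexp n z hz, (hpu n z hz).1]
      have := Complex.exp_ne_zero (v n z)
      have := hu0 n z hz
      field_simp
  obtain ⟨Q, hQd, hQ⟩ := exists_glue (h := fun n z => exp (-v n z) * q n z)
    (fun n => (hvd n).neg.cexp.mul (hq n)) fun n z hz => by
      simp only [Complex.exp_neg, hexp n z hz, (hpu n z hz).2]
      have := Complex.exp_ne_zero (v n z)
      have := hu0 n z hz
      field_simp
  set σ : ℕ → ℂ → ℂ := fun n z => exp (v n z) * s n z with hσ
  set τ : ℕ → ℂ → ℂ := fun n z => exp (v n z) * t n z with hτ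
  have hσd : ∀ n, DifferentiableOn ℂ (σ n) (ball 0 (rad n)) := fun n => (hvd n).cexp.mul (hs n)
  have hτd : ∀ n, DifferentiableOn ℂ (τ n) (ball 0 (rad n)) := fun n => (hvd n).cexp.mul (ht n)
  have hdet : ∀ n, ∀ z ∈ ball (0 : ℂ) (rad n), P z * τ n z - Q z * σ n z = 1 := by
    intro n z hz
    rw [hP n z hz, hQ n z hz, ← (h n z hz).1]
    simp only [hσ, hτ, Complex.exp_neg]
    have := Complex.exp_ne_zero (v n z)
    field_simp
  set b : ℕ → ℂ → ℂ := fun n z => τ n z * σ (n + 1) z - σ n z * τ (n + 1) z with hb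
  obtain ⟨β, hβd, hβ⟩ := exists_cousin (w := b) fun n =>
    ((hτd n).mul (hd hσd n)).sub ((hσd n).mul (hd hτd n))
  obtain ⟨S, hSd, hS⟩ := exists_glue (h := fun n z => σ n z - β n z * P z)
    (fun n => (hσd n).sub ((hβd n).mul (hPd.mono (ball_rad_subset_unit n)))) fun n z hz => by
      have h1 := hdet n z hz
      have h2 := hdet (n + 1) z (hsub n z hz)
      have h3 := hβ n z hz
      simp only [hb] at h3
      linear_combination P z * h3 - σ (n + 1) z * h1 + σ n z * h2
  obtain ⟨T, hTd, hT⟩ := exists_glue (h := fun n z => τ n z - β n z * Q z)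
    (fun n => (hτd n).sub ((hβd n).mul (hQd.mono (ball_rad_subset_unit n)))) fun n z hz => by
      have h1 := hdet n z hz
      have h2 := hdet (n + 1) z (hsub n z hz)
      have h3 := hβ n z hz
      simp only [hb] at h3
      linear_combination Q z * h3 - τ (n + 1) z * h1 + τ n z * h2
  refine ⟨P, Q, S, T, hPd, hQd, hSd, hTd, fun z hz => ?_⟩
  obtain ⟨n, hn⟩ := exists_mem_ball_rad hz
  constructor
  · rw [hS n z hn, hT n z hn]
    linear_combination hdet n z hn
  · rw [hP n z hn, hQ n z hn, toSphere_mul_left (Complex.exp_ne_zero _), (h n z hn).2]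

end Cousin

section UnimodularLift

open Filter Topology

/-- Two functions generating the unit ideal among holomorphic functions on the disk. -/
def HolomorphicallyCoprime (p q : ℂ → ℂ) (r : ℝ) : Prop :=
  ∃ s t : ℂ → ℂ, DifferentiableOn ℂ s (ball 0 r) ∧ DifferentiableOn ℂ t (ball 0 r) ∧
    ∀ z ∈ ball (0 : ℂ) r, p z * t z - q z * s z = 1

theorem HolomorphicallyCoprime.mul {p q₁ q₂ : ℂ → ℂ} {r : ℝ}
    (hp : DifferentiableOn ℂ p (ball 0 r)) (h₁ : HolomorphicallyCoprime p q₁ r)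
    (h₂ : HolomorphicallyCoprime p q₂ r) :
    HolomorphicallyCoprime p (fun z => q₁ z * q₂ z) r := by
  obtain ⟨s₁, t₁, hs₁, ht₁, h₁⟩ := h₁
  obtain ⟨s₂, t₂, hs₂, ht₂, h₂⟩ := h₂
  refine ⟨fun z => -(s₁ z * s₂ z), fun z => t₁ z + t₂ z - p z * t₁ z * t₂ z, (hs₁.mul hs₂).neg,
    (ht₁.add ht₂).sub ((hp.mul ht₁).mul ht₂), fun z hz => ?_⟩
  linear_combination -(q₂ z * s₂ z) * h₁ z hz + (1 - p z * t₁ z) * h₂ z hz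

theorem holomorphicallyCoprime_sub_pow {p : ℂ → ℂ} {r : ℝ} {c : ℂ}
    (hp : DifferentiableOn ℂ p (ball 0 r)) (hc : c ∈ ball (0 : ℂ) r) (hpc : p c ≠ 0) (m : ℕ) :
    HolomorphicallyCoprime p (fun z => (z - c) ^ m) r := by
  induction m with
  | zero =>
    exact ⟨fun _ => -1, fun _ => 0, differentiableOn_const _, differentiableOn_const _, by simp⟩
  | succ m ih =>
    simp only [pow_succ]
    refine ih.mul hp ⟨fun z => dslope p c z / p c, fun _ => (p c)⁻¹,
      ((Complex.differentiableOn_dslope (isOpen_ball.mem_nhds hc)).2 hp).div_const _,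
      differentiableOn_const _, fun z _ => ?_⟩
    have h := sub_smul_dslope p c z
    rw [smul_eq_mul] at h
    field_simp
    linear_combination -h

theorem map_mul_toSphere (a p q : ℂ) :
    OnePoint.map (fun x => a * x) (toSphere p q) = toSphere (a * p) q := by
  by_cases hq : q = 0
  · simp [hq]
  · simp [toSphere_of_ne hq, mul_div_assoc]

theorem hasUnimodularLift_of_finite {r : ℝ} (S : Finset ℂ) {f : ℂ → OnePoint ℂ}
    (hf : HolomorphicOnSphere f (ball 0 r))
    (hS : ∀ z ∈ ball (0 : ℂ) r, f z = OnePoint.infty → z ∈ S) : HasUnimodularLift f r := by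
  classical
  induction S using Finset.induction_on generalizing f with
  | empty =>
    have hne : ∀ z ∈ ball (0 : ℂ) r, f z ≠ OnePoint.infty := fun z hz h => by simpa using hS z hz h
    exact ⟨fun z => finitePart (f z), fun _ => 1, fun _ => -1, fun _ => 0,
      differentiableOn_finitePart isOpen_ball hf hne, differentiableOn_const _,
      differentiableOn_const _, differentiableOn_const _,
      fun z hz => ⟨by simp, by simp [coe_finitePart (hne z hz)]⟩⟩
  | insert c S hcS ih =>
    by_cases hc : c ∈ ball (0 : ℂ) r ∧ f c = OnePoint.infty
    swap
    · refine ih hf fun z hz h => ?_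
      have := hS z hz h
      rw [Finset.mem_insert] at this
      rcases this with rfl | h'
      · exact absurd ⟨hz, h⟩ hc
      · exact h'
    obtain ⟨hc, hfc⟩ := hc
    have hf' := holomorphicOnSphere_iff.1 hf
    obtain ⟨p, q, hp, hq, h0, hpq⟩ := hf' c hc
    have hqc : q c = 0 := by
      rw [← toSphere_eq_infty_iff (p := p c), ← hpq.self_of_nhds, hfc]
    have hpc : p c ≠ 0 := by simpa [hqc] using h0
    have hnz : ¬ ∀ᶠ z in 𝓝 c, q z = 0 := by
      intro h
      have h1 : ∀ᶠ z in 𝓝 c, z ∈ insert c S := by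
        filter_upwards [h, hpq, isOpen_ball.mem_nhds hc] with z hz hz' hzb
        exact hS z hzb (by rw [hz', hz, toSphere_zero_right])
      exact (infinite_of_mem_nhds c h1) (insert c S).finite_toSet
    obtain ⟨m, g, hg, hgc, hqg⟩ := hq.exists_eventuallyEq_pow_smul_nonzero_iff.2 hnz
    have hm : m ≠ 0 := by
      rintro rfl
      have := hqg.self_of_nhds
      simp [hqc] at this
      exact hgc this.symm
    set k : ℂ → OnePoint ℂ := fun z =>
      if z = c then toSphere (p c) (g c) else OnePoint.map (fun x => (z - c) ^ m * x) (f z) with hk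
    have hkc : k c = toSphere (p c) (g c) := by simp [hk]
    have hkne : ∀ z, z ≠ c → k z = OnePoint.map (fun x => (z - c) ^ m * x) (f z) := fun z hz => by
      simp [hk, hz]
    have hpow : ∀ z, z ≠ c → (z - c) ^ m ≠ 0 := fun z hz => pow_ne_zero _ (sub_ne_zero.2 hz)
    have hkh : HolomorphicOnSphere k (ball 0 r) := by
      rw [holomorphicOnSphere_iff]
      intro z hz
      by_cases hzc : z = c
      · subst hzc
        refine ⟨p, g, hp, hg, Or.inl hpc, ?_⟩
        filter_upwards [hpq, hqg] with w hw hw'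
        by_cases hwz : w = z
        · rw [hwz, hkc]
        · rw [hkne w hwz, hw, hw', map_mul_toSphere, smul_eq_mul, toSphere_mul_left (hpow w hwz)]
      · obtain ⟨a, b, ha, hb, hab, hfab⟩ := hf' z hz
        refine ⟨fun w => (w - c) ^ m * a w, b, ((analyticAt_id.sub analyticAt_const).pow m).mul ha,
          hb, hab.imp_left (mul_ne_zero (hpow z hzc)), ?_⟩
        filter_upwards [hfab, eventually_ne_nhds hzc] with w hw hwc
        rw [hkne w hwc, hw, map_mul_toSphere]
    have hkS : ∀ z ∈ ball (0 : ℂ) r, k z = OnePoint.infty → z ∈ S := by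
      intro z hz h
      by_cases hzc : z = c
      · rw [hzc, hkc, toSphere_eq_infty_iff] at h
        exact absurd h hgc
      · rw [hkne z hzc] at h
        have hfz : f z = OnePoint.infty := by
          cases hx : f z using OnePoint.rec with
          | infty => rfl
          | coe x => rw [hx, OnePoint.map_some] at h; exact absurd h (OnePoint.coe_ne_infty _)
        exact (Finset.mem_insert.1 (hS z hz hfz)).resolve_left hzc
    obtain ⟨P, Q, s, t, hP, hQ, hs, ht, h⟩ := ih hkh hkS
    have hPc : P c ≠ 0 := by
      intro hPc
      have h1 := toSphere_eq_cross (hkc.symm.trans (h c hc).2)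
      have h2 := (h c hc).1
      rw [hPc, zero_mul] at h1 h2
      have hQc : Q c ≠ 0 := by
        intro hQc
        simp [hQc] at h2
      exact mul_ne_zero hpc hQc h1
    obtain ⟨s', t', hs', ht', h'⟩ := HolomorphicallyCoprime.mul hP
      (holomorphicallyCoprime_sub_pow hP hc hPc m) ⟨s, t, hs, ht, fun z hz => (h z hz).1⟩
    refine ⟨P, fun z => (z - c) ^ m * Q z, s', t', hP,
      ((differentiableOn_id.sub_const c).pow m).mul hQ, hs', ht', fun z hz => ⟨h' z hz, ?_⟩⟩
    by_cases hzc : z = c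
    · subst hzc
      simp [hfc, hm]
    · have hinj : Function.Injective (OnePoint.map fun x => (z - c) ^ m * x) :=
        Option.map_injective (mul_right_injective₀ (hpow z hzc))
      apply hinj
      rw [← hkne z hzc, (h z hz).2, map_mul_toSphere, toSphere_mul_left (hpow z hzc)]

theorem eventually_ne_infty {f : ℂ → OnePoint ℂ} {r : ℝ} (hf : HolomorphicOnSphere f (ball 0 r))
    (hr : 0 < r) (h0 : f 0 ≠ OnePoint.infty) {z : ℂ} (hz : z ∈ ball (0 : ℂ) r) :
    ∀ᶠ w in 𝓝[≠] z, f w ≠ OnePoint.infty := by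
  have hf' := holomorphicOnSphere_iff.1 hf
  have hU : IsOpen {z | ∀ᶠ w in 𝓝 z, f w = OnePoint.infty} := isOpen_setOfPred_eventually_nhds
  have hV : IsOpen {z | ∀ᶠ w in 𝓝[≠] z, f w ≠ OnePoint.infty} := by
    rw [isOpen_iff_mem_nhds]
    intro z hz
    have h1 := eventually_eventually_nhdsWithin.2 hz
    rw [eventually_nhdsWithin_iff] at h1
    filter_upwards [h1] with y hy
    by_cases hyz : y = z
    · rwa [hyz]
    · have := hy hyz
      rw [isOpen_compl_singleton.nhdsWithin_eq hyz] at this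
      exact this.filter_mono nhdsWithin_le_nhds
  have hdisj : Disjoint {z | ∀ᶠ w in 𝓝[≠] z, f w ≠ OnePoint.infty}
      {z | ∀ᶠ w in 𝓝 z, f w = OnePoint.infty} := by
    rw [Set.disjoint_left]
    intro z h1 h2
    obtain ⟨w, hw, hw'⟩ := ((show ∀ᶠ w in 𝓝[≠] z, f w ≠ OnePoint.infty from h1).and
      (Filter.Eventually.filter_mono nhdsWithin_le_nhds h2)).exists
    exact hw hw'
  refine isPreconnected_ball.subset_left_of_subset_union hV hU hdisj ?_
    ⟨0, mem_ball_self hr, ?_⟩ hz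
  · intro z hz
    obtain ⟨p, q, hp, hq, -, hpq⟩ := hf' z hz
    rcases hq.eventually_eq_zero_or_eventually_ne_zero with h | h
    · right
      filter_upwards [h, hpq] with w hw hw'
      rw [hw', hw, toSphere_zero_right]
    · left
      filter_upwards [h, nhdsWithin_le_nhds hpq] with w hw hw'
      rwa [hw', Ne, toSphere_eq_infty_iff]
  · obtain ⟨p, q, hp, hq, -, hpq⟩ := hf' 0 (mem_ball_self hr)
    have hq0 : q 0 ≠ 0 := by
      rwa [hpq.self_of_nhds, Ne, toSphere_eq_infty_iff] at h0
    filter_upwards [nhdsWithin_le_nhds hpq,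
      nhdsWithin_le_nhds (hq.continuousAt.eventually_ne hq0)] with w hw hw'
    rwa [hw, Ne, toSphere_eq_infty_iff]

theorem finite_poles {f : ℂ → OnePoint ℂ} (hf : HolomorphicOnSphere f (ball 0 1))
    (h0 : f 0 ≠ OnePoint.infty) {r : ℝ} (hr : r < 1) :
    {z ∈ closedBall (0 : ℂ) r | f z = OnePoint.infty}.Finite := by
  by_contra hinf
  obtain ⟨z, hz, hacc⟩ := Set.Infinite.exists_accPt_of_subset_isCompact hinf
    (isCompact_closedBall (0 : ℂ) r) (sep_subset _ _)
  have h1 := eventually_ne_infty hf one_pos h0 (closedBall_subset_ball hr hz)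
  rw [accPt_iff_frequently_nhdsNE] at hacc
  obtain ⟨w, hw, hw'⟩ := (hacc.and_eventually h1).exists
  exact hw' hw.2

theorem hasUnimodularLift_of_ne_infty {f : ℂ → OnePoint ℂ}
    (hf : HolomorphicOnSphere f (ball 0 1)) (h0 : f 0 ≠ OnePoint.infty) :
    HasUnimodularLift f 1 := by
  refine .unit fun n => hasUnimodularLift_of_finite (finite_poles hf h0 (rad_lt_one n)).toFinset
    (fun z hz => hf z (ball_rad_subset_unit n hz)) fun z hz h => ?_
  simpa using ⟨by simpa using (ball_subset_closedBall hz), h⟩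

theorem hasUnimodularLift {f : ℂ → OnePoint ℂ} (hf : HolomorphicOnSphere f (ball 0 1)) :
    HasUnimodularLift f 1 := by
  by_cases h0 : f 0 = OnePoint.infty
  · have hg : HolomorphicOnSphere (fun z => sphereInv (f z)) (ball 0 1) := by
      intro z hz
      obtain ⟨v, hv, h⟩ := hf z hz
      exact ⟨v, hv, by simpa using h.symm⟩
    obtain ⟨p, q, s, t, hp, hq, hs, ht, h⟩ := hasUnimodularLift_of_ne_infty hg
      (by rw [h0, sphereInv_infty]; exact OnePoint.coe_ne_infty _)
    refine ⟨q, p, fun z => -t z, fun z => -s z, hq, hp, ht.neg, hs.neg, fun z hz => ?_⟩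
    obtain ⟨h1, h2⟩ := h z hz
    have hne : p z ≠ 0 ∨ q z ≠ 0 := by
      by_contra! hc
      simp [hc.1, hc.2] at h1
    refine ⟨by linear_combination h1, ?_⟩
    simp only at h2
    rw [← sphereInv_sphereInv (f z), h2, sphereInv_toSphere hne]
  · exact hasUnimodularLift_of_ne_infty hf h0

end UnimodularLift

section Assembly

open Filter Topology

/-- The invertible matrix `[[a, b], [c, d]]`, or `1` if the determinant vanishes. -/
def mkGL (a b c d : ℂ) : GL (Fin 2) ℂ :=
  if h : (!![a, b; c, d] : Matrix (Fin 2) (Fin 2) ℂ).det ≠ 0 then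
    Matrix.GeneralLinearGroup.mkOfDetNeZero _ h else 1

theorem coe_mkGL {a b c d : ℂ} (h : a * d - b * c ≠ 0) :
    (mkGL a b c d : Matrix (Fin 2) (Fin 2) ℂ) = !![a, b; c, d] := by
  have h' : (!![a, b; c, d] : Matrix (Fin 2) (Fin 2) ℂ).det ≠ 0 := by
    rwa [Matrix.det_fin_two_of]
  rw [mkGL, dif_pos h']
  rfl

theorem holomorphicFamily_mkGL {a b c d : ℂ → ℂ} (ha : DifferentiableOn ℂ a (ball 0 1))
    (hb : DifferentiableOn ℂ b (ball 0 1)) (hc : DifferentiableOn ℂ c (ball 0 1))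
    (hd : DifferentiableOn ℂ d (ball 0 1))
    (h : ∀ l ∈ ball (0 : ℂ) 1, a l * d l - b l * c l ≠ 0) :
    HolomorphicFamily fun l => mkGL (a l) (b l) (c l) (d l) := by
  intro i j
  have key : ∀ l ∈ ball (0 : ℂ) 1, mkGL (a l) (b l) (c l) (d l) i j =
      !![a l, b l; c l, d l] i j := fun l hl => by rw [coe_mkGL (h l hl)]
  refine DifferentiableOn.congr ?_ key
  fin_cases i <;> fin_cases j
  exacts [ha, hb, hc, hd]

theorem mkGL_smul_toSphere {a b c d p q : ℂ} (h : a * d - b * c ≠ 0) (hpq : p ≠ 0 ∨ q ≠ 0) :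
    mkGL a b c d • toSphere p q = toSphere (a * p + b * q) (c * p + d * q) := by
  rw [smul_toSphere _ hpq, coe_mkGL h]
  rfl

theorem mkGL_smul_infty {a b c d : ℂ} (h : a * d - b * c ≠ 0) :
    mkGL a b c d • (OnePoint.infty : OnePoint ℂ) = toSphere a c := by
  rw [← toSphere_zero_right 1, mkGL_smul_toSphere h (Or.inl one_ne_zero)]
  simp

theorem mkGL_smul_coe {a b c d : ℂ} (h : a * d - b * c ≠ 0) (z : ℂ) :
    mkGL a b c d • (z : OnePoint ℂ) = toSphere (a * z + b) (c * z + d) := by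
  rw [← toSphere_one_right z, mkGL_smul_toSphere h (Or.inr one_ne_zero)]
  simp

theorem exists_holomorphicFamily {a b c d : ℂ → ℂ} (ha : DifferentiableOn ℂ a (ball 0 1))
    (hb : DifferentiableOn ℂ b (ball 0 1)) (hc : DifferentiableOn ℂ c (ball 0 1))
    (hd : DifferentiableOn ℂ d (ball 0 1))
    (h : ∀ l ∈ ball (0 : ℂ) 1, a l * d l - b l * c l ≠ 0) :
    ∃ G, HolomorphicFamily G ∧
      (∀ l ∈ ball (0 : ℂ) 1, G l • (OnePoint.infty : OnePoint ℂ) = toSphere (a l) (c l)) ∧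
      ∀ l ∈ ball (0 : ℂ) 1, ∀ z : ℂ,
        G l • (z : OnePoint ℂ) = toSphere (a l * z + b l) (c l * z + d l) :=
  ⟨_, holomorphicFamily_mkGL ha hb hc hd h, fun l hl => mkGL_smul_infty (h l hl),
    fun l hl => mkGL_smul_coe (h l hl)⟩

variable {A : Set (OnePoint ℂ)} {f : ℂ → OnePoint ℂ → OnePoint ℂ}

/-- A motion fixes a point of its domain. -/
def Fixes (A : Set (OnePoint ℂ)) (f : ℂ → OnePoint ℂ → OnePoint ℂ) (a : OnePoint ℂ) : Prop :=
  a ∈ A ∧ ∀ l ∈ ball (0 : ℂ) 1, f l a = a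

theorem fixes_conj (hf : IsHolomorphicMotion A f) {G : ℂ → GL (Fin 2) ℂ} {a b : OnePoint ℂ}
    (ha : a ∈ A) (h : ∀ l ∈ ball (0 : ℂ) 1, G l • b = f l a) :
    Fixes {a | G 0 • a ∈ A} (fun l a => (G l)⁻¹ • f l (G 0 • a)) b := by
  have h0 : G 0 • b = a := (h 0 (mem_ball_self one_pos)).trans (hf.2.2 a ha)
  refine ⟨by simpa [h0] using ha, fun l hl => ?_⟩
  simp only [h0, ← h l hl, inv_smul_smul]

theorem fixes_ne_infty (hf : IsHolomorphicMotion A f) (hi : Fixes A f OnePoint.infty) {z : ℂ}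
    (hz : (z : OnePoint ℂ) ∈ A) {l : ℂ} (hl : l ∈ ball (0 : ℂ) 1) :
    f l z ≠ OnePoint.infty := fun h =>
  OnePoint.coe_ne_infty z (hf.2.1 l hl hz hi.1 (h.trans (hi.2 l hl).symm))

theorem extends_of_fixes_infty_zero (hf : IsHolomorphicMotion A f)
    (hi : Fixes A f OnePoint.infty) (h0 : Fixes A f ((0 : ℂ) : OnePoint ℂ)) : Extends A f := by
  by_cases hA : ∃ c : ℂ, (c : OnePoint ℂ) ∈ A ∧ c ≠ 0
  · obtain ⟨c, hc, hc0⟩ := hA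
    set φ : ℂ → ℂ := fun l => finitePart (f l c) with hφ
    have hfφ : ∀ l ∈ ball (0 : ℂ) 1, f l c = (φ l : OnePoint ℂ) := fun l hl =>
      (coe_finitePart (fixes_ne_infty hf hi hc hl)).symm
    have hφd : DifferentiableOn ℂ φ (ball 0 1) :=
      differentiableOn_finitePart isOpen_ball (hf.1 _ hc) fun l hl => fixes_ne_infty hf hi hc hl
    have hφ0 : ∀ l ∈ ball (0 : ℂ) 1, φ l ≠ 0 := fun l hl h => by
      have h1 := hfφ l hl
      rw [h] at h1
      exact hc0 (OnePoint.coe_injective (hf.2.1 l hl hc h0.1 (h1.trans (h0.2 l hl).symm)))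
    have hdet : ∀ l ∈ ball (0 : ℂ) 1, φ l * 1 - 0 * 0 ≠ 0 := fun l hl => by simpa using hφ0 l hl
    obtain ⟨G, hG, hGi, hGz⟩ :=
      exists_holomorphicFamily hφd (differentiableOn_const _) (differentiableOn_const _)
        (differentiableOn_const _) hdet
    refine Extends.of_conj hG ?_
    have hi' := fixes_conj (b := OnePoint.infty) hf hi.1
      fun l hl => by rw [hGi l hl, hi.2 l hl, toSphere_zero_right]
    have h0' := fixes_conj (b := ((0 : ℂ) : OnePoint ℂ)) hf h0.1
      fun l hl => by rw [hGz l hl, h0.2 l hl]; simp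
    have h1' := fixes_conj (b := ((1 : ℂ) : OnePoint ℂ)) hf hc
      fun l hl => by rw [hGz l hl, hfφ l hl]; simp
    exact extends_of_fixed_three (isHolomorphicMotion_conj hf hG) hi'.1 h0'.1 h1'.1
      hi'.2 h0'.2 h1'.2
  · push Not at hA
    refine extends_of_fixed fun l hl a ha => ?_
    induction a using OnePoint.rec with
    | infty => exact hi.2 l hl
    | coe z =>
      obtain rfl := hA z ha
      exact h0.2 l hl

theorem extends_of_fixes_infty (hf : IsHolomorphicMotion A f)
    (hi : Fixes A f OnePoint.infty) : Extends A f := by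
  by_cases hA : ∃ b : ℂ, (b : OnePoint ℂ) ∈ A
  · obtain ⟨b, hb⟩ := hA
    set φ : ℂ → ℂ := fun l => finitePart (f l b) with hφ
    have hfφ : ∀ l ∈ ball (0 : ℂ) 1, f l b = (φ l : OnePoint ℂ) := fun l hl =>
      (coe_finitePart (fixes_ne_infty hf hi hb hl)).symm
    have hφd : DifferentiableOn ℂ φ (ball 0 1) :=
      differentiableOn_finitePart isOpen_ball (hf.1 _ hb) fun l hl => fixes_ne_infty hf hi hb hl
    have hdet : ∀ l ∈ ball (0 : ℂ) 1, (1 : ℂ) * 1 - φ l * 0 ≠ 0 := fun l _ => by simp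
    obtain ⟨G, hG, hGi, hGz⟩ :=
      exists_holomorphicFamily (differentiableOn_const _) hφd (differentiableOn_const _)
        (differentiableOn_const _) hdet
    refine Extends.of_conj hG (extends_of_fixes_infty_zero (isHolomorphicMotion_conj hf hG)
      (fixes_conj hf hi.1 fun l hl => ?_)
      (fixes_conj hf hb fun l hl => ?_))
    · rw [hGi l hl, hi.2 l hl, toSphere_zero_right]
    · rw [hGz l hl, hfφ l hl]
      simp
  · push Not at hA
    refine extends_of_fixed fun l hl a ha => ?_
    induction a using OnePoint.rec with
    | infty => exact hi.2 l hl
    | coe z => exact absurd ha (hA z)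

theorem extends_of_isHolomorphicMotion (hf : IsHolomorphicMotion A f) : Extends A f := by
  rcases A.eq_empty_or_nonempty with rfl | ⟨a, ha⟩
  · exact extends_of_fixed fun _ _ a ha => absurd ha (notMem_empty a)
  · obtain ⟨p, q, s, t, hp, hq, hs, ht, h⟩ := hasUnimodularLift (hf.1 a ha)
    have hdet : ∀ l ∈ ball (0 : ℂ) 1, p l * t l - s l * q l ≠ 0 := fun l hl => by
      rw [mul_comm (s l), (h l hl).1]
      exact one_ne_zero
    obtain ⟨G, hG, hGi, -⟩ :=
      exists_holomorphicFamily hp hs hq ht hdet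
    refine Extends.of_conj hG (extends_of_fixes_infty (isHolomorphicMotion_conj hf hG)
      (fixes_conj hf ha fun l hl => ?_))
    rw [hGi l hl, ← (h l hl).2]

end Assembly

end Slodkowski

/-- **Słodkowski's λ-lemma.** Every holomorphic motion of a set `A ⊆ ℂ̂` over the unit disk
extends to a holomorphic motion of the whole Riemann sphere. -/
theorem slodkowski_lambda_lemma (A : Set (OnePoint ℂ))
    (f : ℂ → OnePoint ℂ → OnePoint ℂ) (hf : IsHolomorphicMotion A f) :
    ∃ F : ℂ → OnePoint ℂ → OnePoint ℂ, IsHolomorphicMotion Set.univ F ∧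
      ∀ l ∈ ball (0 : ℂ) 1, ∀ a ∈ A, F l a = f l a := by
  exact Slodkowski.extends_of_isHolomorphicMotion hf
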